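/- There exist absolute constants C > 0 and c0 > 0 such that for every integer q ≥ 3 the following holds. If no nonprincipal Dirichlet character modulo q has a real zero β with β ≥ 1 − c0/log q, then |Σ_{χ ≠ χ0, χ(−1)=1} |L(1,χ)|^{−2} − (ζ(2)/(2ζ(4))) · ∏_{p | q} (1 + p^{−2})^{−1} · φ(q)| ≤ exp(C·log q/log log q). If instead some nonprincipal real character χ1 modulo q has a real zero β1 with β1 ≥ 1 − c0/log q (the exceptional zero), then |Σ_{χ ≠ χ0, χ(−1)=1} |L(1,χ)|^{−2} − (ζ(2)/(2ζ(4))) · ∏_{p | q} (1 + p^{−2})^{−1} · φ(q)| ≤ exp(C·log q/log log q) + C·(1−β1)^{−1}·((log q)^2 + (1−β1)^{−1}). -/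

import Mathlib

namespace NSM
open Finset

lemma sum_block_char {q : ℕ} [NeZero q] (χ : DirichletCharacter ℂ q) (hχ : χ ≠ 1) (k : ℕ) :
    ∑ a ∈ range q, χ ((k * q + a + 1 : ℕ) : ZMod q) = 0 := by
  rw [← MulChar.sum_eq_zero_of_ne_one hχ]
  refine Finset.sum_bij (fun a _ => ((k * q + a + 1 : ℕ) : ZMod q)) (fun _ _ => mem_univ _) ?_ ?_ ?_
  · intro a ha b hb hab
    rw [mem_range] at ha hb
    have : (a : ZMod q) = (b : ZMod q) := by simpa using hab
    rw [ZMod.natCast_eq_natCast_iff'] at this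
    rwa [Nat.mod_eq_of_lt ha, Nat.mod_eq_of_lt hb] at this
  · intro b _
    refine ⟨(b - 1).val, mem_range.2 (ZMod.val_lt _), ?_⟩
    simp
  · intro a _; rfl

lemma norm_cpow_sub_le {m n : ℝ} (hm : 0 < m) (hmn : m ≤ n) {s : ℂ} (hs : 0 < s.re) :
    ‖(n : ℂ) ^ (-s) - (m : ℂ) ^ (-s)‖ ≤ ‖s‖ * m ^ (-s.re - 1) * (n - m) := by
  have hder : ∀ t ∈ Set.Icc m n, HasDerivWithinAt (fun t : ℝ => (t : ℂ) ^ (-s))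
      (-s * (t : ℂ) ^ (-s - 1)) (Set.Icc m n) t := by
    intro t ht
    have ht0 : 0 < t := hm.trans_le ht.1
    have h2 := ((hasDerivAt_id (t : ℂ)).cpow_const (c := -s)
      (Or.inl (by simpa using ht0))).comp_ofReal
    simpa using h2.hasDerivWithinAt
  have hb : ∀ t ∈ Set.Icc m n, ‖-s * (t : ℂ) ^ (-s - 1)‖ ≤ ‖s‖ * m ^ (-s.re - 1) := by
    intro t ht
    have ht0 : 0 < t := hm.trans_le ht.1
    rw [norm_mul, norm_neg, Complex.norm_cpow_eq_rpow_re_of_pos ht0]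
    gcongr ?_ * ?_
    simp only [Complex.sub_re, Complex.neg_re, Complex.one_re]
    exact Real.rpow_le_rpow_of_nonpos hm ht.1 (by linarith)
  have := (convex_Icc m n).norm_image_sub_le_of_norm_hasDerivWithin_le hder hb
    (Set.left_mem_Icc.2 hmn) (Set.right_mem_Icc.2 hmn)
  simpa [Real.norm_eq_abs, abs_of_nonneg (sub_nonneg.2 hmn)] using this

/-- Block of the Dirichlet series over `kq < n ≤ (k+1)q`. -/
noncomputable def blk {q : ℕ} (χ : DirichletCharacter ℂ q) (k : ℕ) (s : ℂ) : ℂ :=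
  ∑ a ∈ range q, χ ((k * q + a + 1 : ℕ) : ZMod q) * ((k * q + a + 1 : ℕ) : ℂ) ^ (-s)

lemma norm_blk_le {q : ℕ} [NeZero q] (χ : DirichletCharacter ℂ q) (hχ : χ ≠ 1) {k : ℕ}
    (hk : 1 ≤ k) {s : ℂ} (hs : 0 < s.re) :
    ‖blk χ k s‖ ≤ ‖s‖ * (q : ℝ) ^ (1 - s.re) * (k : ℝ) ^ (-s.re - 1) := by
  have hq : (0 : ℝ) < q := by exact_mod_cast Nat.pos_of_ne_zero (NeZero.ne q)
  have hk0 : (0 : ℝ) < k := by exact_mod_cast hk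
  have h1 : blk χ k s = ∑ a ∈ range q, χ ((k * q + a + 1 : ℕ) : ZMod q) *
      (((k * q + a + 1 : ℕ) : ℂ) ^ (-s) - ((k * q : ℝ) : ℂ) ^ (-s)) := by
    simp_rw [mul_sub]
    rw [sum_sub_distrib, ← sum_mul, sum_block_char χ hχ, zero_mul, sub_zero, blk]
  rw [h1]
  have h2 : ∀ a ∈ range q, ‖χ ((k * q + a + 1 : ℕ) : ZMod q) *
      (((k * q + a + 1 : ℕ) : ℂ) ^ (-s) - ((k * q : ℝ) : ℂ) ^ (-s))‖ ≤
      ‖s‖ * (k * q : ℝ) ^ (-s.re - 1) * q := by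
    intro a ha
    rw [norm_mul]
    have h3 := DirichletCharacter.norm_le_one χ ((k * q + a + 1 : ℕ) : ZMod q)
    have h4 : ((k * q + a + 1 : ℕ) : ℂ) = (((k * q + a + 1 : ℕ) : ℝ) : ℂ) := by push_cast; rfl
    have ha' : ((a + 1 : ℕ) : ℝ) ≤ q := by exact_mod_cast mem_range.1 ha
    push_cast at ha'
    have h5 := norm_cpow_sub_le (m := (k * q : ℝ)) (n := ((k * q + a + 1 : ℕ) : ℝ)) (by positivity)
      (by push_cast; linarith [Nat.cast_nonneg (α := ℝ) a]) hs
    rw [h4]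
    calc _ ≤ 1 * (‖s‖ * (k * q : ℝ) ^ (-s.re - 1) * (((k * q + a + 1 : ℕ) : ℝ) - k * q)) := by
          gcongr
      _ ≤ _ := by
          rw [one_mul]; gcongr; push_cast; linarith
  refine (norm_sum_le_of_le _ h2).trans (le_of_eq ?_)
  rw [sum_const, card_range, nsmul_eq_mul, Real.mul_rpow hk0.le hq.le]
  have : (q : ℝ) ^ (1 - s.re) = q ^ (-s.re - 1) * q * q := by
    rw [← Real.rpow_add_one hq.ne', ← Real.rpow_add_one hq.ne']; congr 1; ring
  rw [this]; ring

lemma sum_range_blk {q : ℕ} (χ : DirichletCharacter ℂ q) (K : ℕ) (s : ℂ) :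
    ∑ k ∈ range K, blk χ k s =
      ∑ n ∈ range (K * q), χ ((n + 1 : ℕ) : ZMod q) * ((n + 1 : ℕ) : ℂ) ^ (-s) := by
  induction K with
  | zero => simp
  | succ K ih =>
    rw [sum_range_succ, ih, Nat.succ_mul, sum_range_add]
    rfl

lemma summable_rpow {σ : ℝ} (hσ : 0 < σ) : Summable (fun k : ℕ => (k : ℝ) ^ (-σ - 1)) :=
  Real.summable_nat_rpow.2 (by linarith)

lemma differentiable_blk {q : ℕ} (χ : DirichletCharacter ℂ q) (k : ℕ) :
    Differentiable ℂ (blk χ k) := by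
  intro s
  unfold blk
  refine DifferentiableAt.fun_sum fun a _ => ?_
  refine DifferentiableAt.const_mul ?_ _
  refine DifferentiableAt.const_cpow (by fun_prop) (Or.inl ?_)
  exact Nat.cast_ne_zero.2 (Nat.succ_ne_zero _)

lemma summable_blk {q : ℕ} [NeZero q] (χ : DirichletCharacter ℂ q) (hχ : χ ≠ 1)
    {s : ℂ} (hs : 0 < s.re) : Summable (fun k => blk χ k s) := by
  rw [← summable_nat_add_iff 1]
  refine Summable.of_norm_bounded
    (g := fun k : ℕ => ‖s‖ * (q : ℝ) ^ (1 - s.re) * ((k + 1 : ℕ) : ℝ) ^ (-s.re - 1)) ?_ ?_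
  · exact ((summable_nat_add_iff 1).2 (summable_rpow hs)).mul_left _
  · intro k
    exact norm_blk_le χ hχ (Nat.succ_pos k) hs

lemma tsum_blk_of_one_lt {q : ℕ} [NeZero q] (χ : DirichletCharacter ℂ q) (hχ : χ ≠ 1)
    {s : ℂ} (hs : 1 < s.re) : ∑' k, blk χ k s = χ.LFunction s := by
  have h1 := (summable_blk χ hχ (s := s) (by linarith)).hasSum.tendsto_sum_nat
  have h2 := (DirichletCharacter.LSeriesSummable_of_one_lt_re χ hs).hasSum
  have h3 : LSeries (fun n => χ n) s = χ.LFunction s :=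
    (DirichletCharacter.LFunction_eq_LSeries χ hs).symm
  have h4 := (hasSum_nat_add_iff' 1).2 h2
  have h5 := h4.tendsto_sum_nat
  have hq : 0 < q := Nat.pos_of_ne_zero (NeZero.ne q)
  have h6 := h5.comp (Filter.tendsto_atTop_mono (fun K : ℕ => Nat.le_mul_of_pos_right K hq)
    Filter.tendsto_id)
  refine tendsto_nhds_unique h1 ?_
  rw [← h3]
  have h7 : LSeries (fun n => χ n) s = (∑' n, LSeries.term (fun n => χ n) s n -
     ∑ i ∈ range 1, LSeries.term (fun n => χ n) s i) := by
    simp [LSeries]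
  rw [h7]
  refine h6.congr fun K => ?_
  simp only [Function.comp]
  rw [sum_range_blk]
  refine sum_congr rfl fun n _ => ?_
  rw [LSeries.term_of_ne_zero (Nat.succ_ne_zero n), Complex.cpow_neg]
  rfl

lemma hasSum_blk {q : ℕ} [NeZero q] (χ : DirichletCharacter ℂ q) (hχ : χ ≠ 1)
    {s : ℂ} (hs : 0 < s.re) : HasSum (fun k => blk χ k s) (χ.LFunction s) := by
  have hsum := summable_blk χ hχ hs
  suffices h : ∑' k, blk χ k s = χ.LFunction s by rw [← h]; exact hsum.hasSum
  have hU : IsOpen {s : ℂ | 0 < s.re} := isOpen_lt continuous_const Complex.continuous_re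
  have hd : DifferentiableOn ℂ (fun s => ∑' k, blk χ k s) {s : ℂ | 0 < s.re} := by
    intro z hz
    have hz' : 0 < z.re := hz
    -- local neighbourhood
    set V : Set ℂ := {w | z.re / 2 < w.re} ∩ Metric.ball 0 (‖z‖ + 1) with hV
    have hVo : IsOpen V := (isOpen_lt continuous_const Complex.continuous_re).inter Metric.isOpen_ball
    have hzV : z ∈ V := ⟨by simp only [Set.mem_ofPred_eq]; linarith, by simp⟩
    have hq1 : (1 : ℝ) ≤ q := by exact_mod_cast Nat.pos_of_ne_zero (NeZero.ne q)
    have hdV : DifferentiableOn ℂ (fun s => ∑' k, blk χ (k + 1) s) V := by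
      refine Complex.differentiableOn_tsum_of_summable_norm
        (u := fun k : ℕ => (‖z‖ + 1) * (q : ℝ) * ((k + 1 : ℕ) : ℝ) ^ (-(z.re / 2) - 1)) ?_ ?_ hVo ?_
      · exact ((summable_nat_add_iff 1).2 (summable_rpow (by linarith))).mul_left _
      · intro k; exact (differentiable_blk χ _).differentiableOn
      · intro k w hw
        have hw1 : z.re / 2 < w.re := hw.1
        have hw2 : ‖w‖ ≤ ‖z‖ + 1 := by have := hw.2; simp at this; exact this.le
        refine (norm_blk_le χ hχ (Nat.succ_pos k) (by linarith)).trans ?_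
        gcongr
        · calc (q : ℝ) ^ (1 - w.re) ≤ (q : ℝ) ^ (1 : ℝ) :=
                Real.rpow_le_rpow_of_exponent_le hq1 (by linarith)
            _ = q := Real.rpow_one _
        · exact_mod_cast Nat.succ_pos k
    have hE : ∀ w ∈ V, ∑' k, blk χ k w = blk χ 0 w + ∑' k, blk χ (k + 1) w := by
      intro w hw
      have hw1 : z.re / 2 < w.re := hw.1
      exact (summable_blk χ hχ (by linarith)).tsum_eq_zero_add
    have : DifferentiableOn ℂ (fun s => ∑' k, blk χ k s) V :=
      (((differentiable_blk χ 0).differentiableOn).add hdV).congr hE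
    exact (this.differentiableAt (hVo.mem_nhds hzV)).differentiableWithinAt
  have hpre : IsPreconnected {s : ℂ | 0 < s.re} := (convex_halfSpace_re_gt 0).isPreconnected
  have := (hd.analyticOnNhd hU).eqOn_of_preconnected_of_eventuallyEq
    ((DirichletCharacter.differentiable_LFunction hχ).differentiableOn.analyticOnNhd hU) hpre
    (z₀ := 2) (by simp) ?_
  · exact this hs
  · have : {s : ℂ | 1 < s.re} ∈ nhds (2 : ℂ) :=
      (isOpen_lt continuous_const Complex.continuous_re).mem_nhds (by simp)
    filter_upwards [this] with w hw
    exact tsum_blk_of_one_lt χ hχ hw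

lemma norm_LFunction_sub_le {q : ℕ} [NeZero q] (χ : DirichletCharacter ℂ q) (hχ : χ ≠ 1)
    {s : ℂ} (hs : 0 < s.re) {K : ℕ} (hK : 1 ≤ K) :
    ‖χ.LFunction s - ∑ n ∈ range (K * q), χ ((n + 1 : ℕ) : ZMod q) * ((n + 1 : ℕ) : ℂ) ^ (-s)‖ ≤
      ‖s‖ * (q : ℝ) ^ (1 - s.re) * ∑' k : ℕ, ((k + K : ℕ) : ℝ) ^ (-s.re - 1) := by
  rw [← sum_range_blk]
  have h := (hasSum_nat_add_iff' K).2 (hasSum_blk χ hχ hs)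
  rw [← h.tsum_eq, ← tsum_mul_left]
  refine tsum_of_norm_bounded (Summable.hasSum ?_) fun k => norm_blk_le χ hχ (by omega) hs
  exact ((summable_nat_add_iff K).2 (summable_rpow hs)).mul_left _

end NSM

namespace NSM
open Finset

lemma one_lt_log {q : ℕ} (hq : 3 ≤ q) : 1 < Real.log q := by
  rw [Real.lt_log_iff_exp_lt (by positivity)]
  have : (3 : ℝ) ≤ q := by exact_mod_cast hq
  linarith [Real.exp_one_lt_d9]

lemma tsum_inv_sq_le {K : ℕ} (hK : 1 ≤ K) :
    ∑' k : ℕ, ((k + K : ℕ) : ℝ) ^ (-(1 : ℝ) - 1) ≤ 2 / K := by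
  have hK0 : (1 : ℝ) ≤ K := by exact_mod_cast hK
  have key : ∀ n : ℕ, ∑ k ∈ range n, ((k + K : ℕ) : ℝ) ^ (-(1 : ℝ) - 1) ≤
      2 / K - 2 / (K + n : ℝ) := by
    intro n
    induction n with
    | zero => simp
    | succ n ih =>
      rw [sum_range_succ]
      have h1 : ((n + K : ℕ) : ℝ) ^ (-(1 : ℝ) - 1) = 1 / (K + n : ℝ) ^ 2 := by
        rw [show (-(1 : ℝ) - 1) = -(2 : ℕ) by norm_num, Real.rpow_neg (by positivity),
          Real.rpow_natCast]
        push_cast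
        rw [add_comm, one_div]
      rw [h1]
      have hx : (1 : ℝ) ≤ K + n := by linarith [Nat.cast_nonneg (α := ℝ) n]
      have h2 : 1 / (K + n : ℝ) ^ 2 ≤ 2 / (K + n : ℝ) - 2 / (K + (n + 1 : ℕ) : ℝ) := by
        push_cast
        rw [← add_assoc]
        generalize (K + n : ℝ) = x at hx
        rw [div_sub_div _ _ (by positivity) (by positivity), div_le_div_iff₀ (by positivity)
          (by positivity)]
        nlinarith [mul_nonneg (sub_nonneg.2 hx) (sq_nonneg x)]
      linarith
  refine Real.tsum_le_of_sum_range_le (fun k => by positivity) fun n => (key n).trans ?_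
  have : 0 ≤ 2 / (K + n : ℝ) := by positivity
  linarith

lemma L_one_approx {q : ℕ} [NeZero q] (χ : DirichletCharacter ℂ q) (hχ : χ ≠ 1)
    {K : ℕ} (hK : 1 ≤ K) :
    ‖χ.LFunction 1 - ∑ n ∈ range (K * q), χ ((n + 1 : ℕ) : ZMod q) / ((n + 1 : ℕ) : ℂ)‖ ≤ 2 / K := by
  have h := norm_LFunction_sub_le χ hχ (s := 1) (by simp) hK
  simp only [Complex.one_re, norm_one, sub_self, Real.rpow_zero, one_mul, Complex.cpow_neg_one,
    ← div_eq_mul_inv] at h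
  exact h.trans (tsum_inv_sq_le hK)

/-- constant -/
noncomputable def cc : ℝ := ∑' k : ℕ, ((k + 1 : ℕ) : ℝ) ^ (-(1 / 2 : ℝ) - 1)

lemma cc_nonneg : 0 ≤ cc := tsum_nonneg fun k => by positivity

lemma tsum_le_cc {σ : ℝ} (hσ : 1 / 2 ≤ σ) : ∑' k : ℕ, ((k + 1 : ℕ) : ℝ) ^ (-σ - 1) ≤ cc := by
  refine Summable.tsum_le_tsum (fun k => ?_) ((summable_nat_add_iff 1).2 (summable_rpow (by linarith)))
    ((summable_nat_add_iff 1).2 (summable_rpow (by norm_num)))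
  exact Real.rpow_le_rpow_of_exponent_le (by simp) (by linarith)

lemma L_bound_aux {q : ℕ} [NeZero q] (χ : DirichletCharacter ℂ q) (hχ : χ ≠ 1) {s : ℂ}
    (hs : 1 / 2 ≤ s.re) (hs4 : ‖s‖ ≤ 4) :
    ‖χ.LFunction s‖ ≤ ∑ n ∈ range q, ((n + 1 : ℕ) : ℝ) ^ (-s.re) + 4 * (q : ℝ) ^ (1 - s.re) * cc := by
  have h := norm_LFunction_sub_le χ hχ (s := s) (by linarith) le_rfl
  rw [one_mul] at h
  have h1 : ‖∑ n ∈ range q, χ ((n + 1 : ℕ) : ZMod q) * ((n + 1 : ℕ) : ℂ) ^ (-s)‖ ≤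
      ∑ n ∈ range q, ((n + 1 : ℕ) : ℝ) ^ (-s.re) := by
    refine norm_sum_le_of_le _ fun n _ => ?_
    rw [norm_mul, Complex.norm_natCast_cpow_of_pos (Nat.succ_pos n), Complex.neg_re]
    exact mul_le_of_le_one_left (by positivity) (DirichletCharacter.norm_le_one χ _)
  have h2 : ‖s‖ * (q : ℝ) ^ (1 - s.re) * ∑' k : ℕ, ((k + 1 : ℕ) : ℝ) ^ (-s.re - 1) ≤
      4 * (q : ℝ) ^ (1 - s.re) * cc := by
    gcongr
    exact tsum_le_cc hs
  have h3 := norm_le_norm_add_norm_sub (∑ n ∈ range q, χ ((n + 1 : ℕ) : ZMod q) * ((n + 1 : ℕ) : ℂ) ^ (-s)) (χ.LFunction s)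
  rw [norm_sub_rev] at h3
  linarith

lemma L_bound_q : ∃ C : ℝ, 1 ≤ C ∧ ∀ (q : ℕ) [NeZero q] (χ : DirichletCharacter ℂ q), χ ≠ 1 →
    ∀ s : ℂ, 1 / 2 ≤ s.re → ‖s‖ ≤ 4 → ‖χ.LFunction s‖ ≤ C * q := by
  refine ⟨1 + 4 * cc, by linarith [cc_nonneg], fun q _ χ hχ s hs hs4 => ?_⟩
  refine (L_bound_aux χ hχ hs hs4).trans ?_
  have hq1 : (1 : ℝ) ≤ q := by exact_mod_cast Nat.pos_of_ne_zero (NeZero.ne q)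
  have h1 : ∑ n ∈ range q, ((n + 1 : ℕ) : ℝ) ^ (-s.re) ≤ q := by
    calc _ ≤ ∑ n ∈ range q, (1 : ℝ) := sum_le_sum fun n _ =>
          Real.rpow_le_one_of_one_le_of_nonpos (by simp) (by linarith)
      _ = q := by simp
  have h2 : (q : ℝ) ^ (1 - s.re) ≤ q := by
    calc (q : ℝ) ^ (1 - s.re) ≤ (q : ℝ) ^ (1 : ℝ) :=
          Real.rpow_le_rpow_of_exponent_le hq1 (by linarith)
      _ = q := Real.rpow_one _
  have h3 : 4 * (q : ℝ) ^ (1 - s.re) * cc ≤ 4 * q * cc := by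
    gcongr; exact cc_nonneg
  linarith

lemma sum_inv_le_log (q : ℕ) : ∑ n ∈ range q, (((n + 1 : ℕ) : ℝ))⁻¹ ≤ 1 + Real.log q := by
  have := harmonic_le_one_add_log q
  simpa [harmonic] using this

lemma L_bound_log : ∃ C : ℝ, 1 ≤ C ∧ ∀ (q : ℕ) [NeZero q], 3 ≤ q →
    ∀ (χ : DirichletCharacter ℂ q), χ ≠ 1 →
    ∀ s : ℂ, ‖s - 1‖ ≤ 1 / (2 * Real.log q) → ‖χ.LFunction s‖ ≤ C * Real.log q := by
  refine ⟨4 + 8 * cc, by linarith [cc_nonneg], fun q _ hq χ hχ s hs => ?_⟩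
  have hl := one_lt_log hq
  have hq0 : (0 : ℝ) < q := by positivity
  have hre : |s.re - 1| ≤ 1 / (2 * Real.log q) := by
    have := Complex.abs_re_le_norm (s - 1)
    simp at this ⊢; simp at hs; linarith
  have hhalf : 1 / (2 * Real.log q) ≤ 1 / 2 := by
    apply one_div_le_one_div_of_le <;> linarith
  have hre1 := abs_le.1 hre
  have hs4 : ‖s‖ ≤ 4 := by
    have := norm_le_norm_add_norm_sub (1 : ℂ) s
    rw [norm_sub_rev, norm_one] at this; linarith
  have h2 : ∀ x : ℝ, 1 ≤ x → x ≤ q → x ^ (1 - s.re) ≤ 2 := by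
    intro x hx hxq
    have hlx : Real.log x ≤ Real.log q := Real.log_le_log (by linarith) hxq
    have hlx0 : 0 ≤ Real.log x := Real.log_nonneg hx
    rw [Real.rpow_def_of_pos (by linarith)]
    have : Real.log x * (1 - s.re) ≤ 1 / 2 := by
      calc Real.log x * (1 - s.re) ≤ Real.log x * (1 / (2 * Real.log q)) := by
            gcongr; linarith
        _ ≤ Real.log q * (1 / (2 * Real.log q)) := by gcongr
        _ = 1 / 2 := by field_simp
    have h3 : Real.exp (Real.log x * (1 - s.re)) ≤ Real.exp (1 / 2) := Real.exp_le_exp.2 this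
    have h4 : Real.exp (1 / 2) ^ 2 ≤ 2 ^ 2 := by
      rw [← Real.exp_nat_mul]; norm_num; linarith [Real.exp_one_lt_d9]
    have h5 := (sq_le_sq₀ (Real.exp_pos _).le (by norm_num)).1 h4
    linarith
  refine (L_bound_aux χ hχ (by linarith) hs4).trans ?_
  have h6 : ∑ n ∈ range q, ((n + 1 : ℕ) : ℝ) ^ (-s.re) ≤ 2 * (1 + Real.log q) := by
    calc _ ≤ ∑ n ∈ range q, 2 * (((n + 1 : ℕ) : ℝ))⁻¹ := by
          refine sum_le_sum fun n hn => ?_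
          have hp : (0 : ℝ) < ((n + 1 : ℕ) : ℝ) := by positivity
          have : ((n + 1 : ℕ) : ℝ) ^ (-s.re) = ((n + 1 : ℕ) : ℝ) ^ (1 - s.re) * (((n + 1 : ℕ) : ℝ))⁻¹ := by
            rw [← Real.rpow_neg_one, ← Real.rpow_add hp]; congr 1; ring
          rw [this]
          gcongr
          exact h2 _ (by simp) (by exact_mod_cast mem_range.1 hn)
      _ = 2 * ∑ n ∈ range q, (((n + 1 : ℕ) : ℝ))⁻¹ := by rw [mul_sum]
      _ ≤ _ := by gcongr; exact sum_inv_le_log q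
  have h7 : 4 * (q : ℝ) ^ (1 - s.re) * cc ≤ 4 * 2 * cc := by
    have := h2 q (by exact_mod_cast (by omega : 1 ≤ q)) le_rfl
    gcongr; exact cc_nonneg
  nlinarith [cc_nonneg]

/-- combined bound: size and Lipschitz near 1 -/
lemma L_near_one : ∃ C : ℝ, 1 ≤ C ∧ ∀ (q : ℕ) [NeZero q], 3 ≤ q →
    ∀ (χ : DirichletCharacter ℂ q), χ ≠ 1 →
    ∀ s : ℂ, ‖s - 1‖ < 1 / (2 * Real.log q) → ‖χ.LFunction s‖ ≤ C * Real.log q ∧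
      ‖χ.LFunction s - χ.LFunction 1‖ ≤ C * Real.log q ^ 2 * ‖s - 1‖ := by
  obtain ⟨C, hC1, hC⟩ := L_bound_log
  refine ⟨4 * C, by linarith, fun q _ hq χ hχ s hs => ?_⟩
  have hl := one_lt_log hq
  constructor
  · refine (hC q hq χ hχ s hs.le).trans ?_
    nlinarith
  · have := Complex.dist_le_div_mul_dist_of_mapsTo_ball (f := χ.LFunction) (c := 1)
      (R₁ := 1 / (2 * Real.log q)) (R₂ := 2 * (C * Real.log q)) (z := s)
      (DirichletCharacter.differentiable_LFunction hχ).differentiableOn ?_ (by simpa [dist_eq_norm] using hs)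
    · rw [dist_eq_norm, dist_eq_norm] at this
      refine this.trans (le_of_eq ?_)
      field_simp
      ring
    · intro w hw
      rw [Metric.mem_ball, dist_eq_norm] at hw
      rw [Metric.mem_closedBall, dist_eq_norm]
      have h1 := hC q hq χ hχ w hw.le
      have h2 := hC q hq χ hχ 1 (by simp; linarith)
      exact (norm_sub_le _ _).trans (by linarith)

lemma char_real {q : ℕ} {χ : DirichletCharacter ℂ q} (hχ : χ ^ 2 = 1) (a : ZMod q) :
    (χ a).im = 0 := by
  rcases MulChar.isQuadratic_iff_sq_eq_one.mpr hχ a with h | h | h <;> simp [h]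

lemma L_real {q : ℕ} [NeZero q] {χ : DirichletCharacter ℂ q} (hχ : χ ≠ 1) (h2 : χ ^ 2 = 1)
    {σ : ℝ} (hσ : 0 < σ) : (χ.LFunction (σ : ℂ)).im = 0 := by
  have h := Complex.hasSum_im (hasSum_blk χ hχ (s := (σ : ℂ)) (by simpa using hσ))
  rw [← h.tsum_eq]
  have : ∀ k, (blk χ k (σ : ℂ)).im = 0 := by
    intro k
    rw [blk, Complex.im_sum]
    refine sum_eq_zero fun a _ => ?_
    have h3 : ((k * q + a + 1 : ℕ) : ℂ) ^ (-(σ : ℂ)) = ((((k * q + a + 1 : ℕ) : ℝ) ^ (-σ) : ℝ) : ℂ) := by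
      rw [Complex.ofReal_cpow (by positivity)]; push_cast; rfl
    rw [h3, Complex.im_mul_ofReal, char_real h2, zero_mul]
  simp [this]

end NSM

namespace NSM
open Finset
open scoped ComplexOrder

lemma real_taylor (r : ℕ → ℝ) (l A x h : ℝ) (M : ℕ) (hM1 : 1 ≤ M) (hx1 : 1 < x) (hx2 : x ≤ 9 / 8)
    (hA0 : 0 ≤ A)
    (h0 : 1 - l ≤ r 0) (hr : ∀ m, -l ≤ r m) (hrA : ∀ m, |r m| ≤ A * (3 / 4) ^ m)
    (hs : HasSum (fun m => r m * x ^ m) h) (hM : A * (32 / 5) * (27 / 32) ^ M ≤ 1 / 2) :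
    1 / 2 - l * ((x ^ M - 1) / (x - 1)) ≤ h := by
  have h1 := (hasSum_nat_add_iff' M).2 hs
  have hterm : ∀ m, |r m * x ^ m| ≤ A * (27 / 32) ^ m := by
    intro m
    rw [abs_mul, abs_of_nonneg (by positivity : 0 ≤ x ^ m)]
    calc |r m| * x ^ m ≤ (A * (3 / 4) ^ m) * (9 / 8) ^ m := by
          gcongr; exact hrA m
      _ = A * (27 / 32) ^ m := by rw [mul_assoc, ← mul_pow]; norm_num
  have hg : HasSum (fun m : ℕ => A * (27 / 32 : ℝ) ^ (m + M)) (A * (32 / 5) * (27 / 32) ^ M) := by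
    have := (hasSum_geometric_of_lt_one (r := (27 / 32 : ℝ)) (by norm_num) (by norm_num)).mul_left
      (A * (27 / 32 : ℝ) ^ M)
    have e1 : (fun m : ℕ => A * (27 / 32 : ℝ) ^ (m + M)) =
        fun m : ℕ => A * (27 / 32 : ℝ) ^ M * (27 / 32) ^ m := by
      funext m; rw [pow_add]; ring
    have e2 : A * (32 / 5) * (27 / 32) ^ M = A * (27 / 32 : ℝ) ^ M * (1 - 27 / 32)⁻¹ := by
      norm_num; ring
    rw [e1, e2]; exact this
  have h2 : |h - ∑ i ∈ range M, r i * x ^ i| ≤ A * (32 / 5) * (27 / 32) ^ M := by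
    rw [← h1.tsum_eq, ← Real.norm_eq_abs]
    exact tsum_of_norm_bounded hg fun m => by rw [Real.norm_eq_abs]; exact hterm _
  have h3 : 1 - l * ((x ^ M - 1) / (x - 1)) ≤ ∑ i ∈ range M, r i * x ^ i := by
    rw [← geom_sum_eq hx1.ne', mul_sum]
    obtain ⟨N, rfl⟩ : ∃ N, M = N + 1 := ⟨M - 1, by omega⟩
    rw [sum_range_succ', sum_range_succ' (fun i => r i * x ^ i)]
    have : ∑ k ∈ range N, -(l * x ^ (k + 1)) ≤ ∑ k ∈ range N, r (k + 1) * x ^ (k + 1) :=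
      sum_le_sum fun k _ => by
        have := mul_le_mul_of_nonneg_right (hr (k + 1)) (by positivity : 0 ≤ x ^ (k + 1))
        linarith
    rw [sum_neg_distrib] at this
    simp only [pow_zero, mul_one]
    linarith
  have := (abs_le.1 h2).1
  linarith

lemma taylor_lower {a : ℕ → ℂ} (ha : 0 ≤ a) (ha1 : a 1 = 1)
    (hsum : ∀ s : ℂ, 1 < s.re → LSeriesSummable a s) {Φ : ℂ → ℂ} (hd : Differentiable ℂ Φ)
    (hΦ : ∀ s : ℂ, 1 < s.re → Φ s = (s - 1) * LSeries a s) {A : ℝ}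
    (hA : ∀ s ∈ Metric.sphere (2 : ℂ) (4 / 3), ‖Φ s‖ ≤ A) (hA1 : ‖Φ 1‖ ≤ A)
    {β : ℝ} (hβ : 7 / 8 ≤ β) (hβ1 : β < 1) (hβ0 : 0 ≤ (Φ β).re) {M : ℕ} (hM1 : 1 ≤ M)
    (hM : 6 * A * (32 / 5) * (27 / 32) ^ M ≤ 1 / 2) :
    (1 - β) / 2 ≤ (Φ 1).re * (2 - β) ^ M := by
  have hA0 : 0 ≤ A := (norm_nonneg _).trans hA1
  set H : ℂ → ℂ := dslope Φ 1 with hH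
  have hHd : Differentiable ℂ H := by
    rw [← differentiableOn_univ, Complex.differentiableOn_dslope Filter.univ_mem,
      differentiableOn_univ]
    exact hd
  have hHe : ∀ s : ℂ, s ≠ 1 → H s = (Φ s - Φ 1) / (s - 1) := by
    intro s hs
    rw [hH, dslope_of_ne _ hs, slope_def_field]
  have hbound : ∀ z ∈ Metric.sphere (2 : ℂ) (4 / 3), ‖H z‖ ≤ 6 * A := by
    intro z hz
    have hz' : ‖z - 2‖ = 4 / 3 := by simpa [dist_eq_norm] using hz
    have h1 : 1 / 3 ≤ ‖z - 1‖ := by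
      have := norm_add_le (z - 1) (-1)
      rw [show z - 1 + -1 = z - 2 by ring, hz', norm_neg, norm_one] at this
      linarith
    have hne : z ≠ 1 := by
      rintro rfl; simp at h1; norm_num at h1
    rw [hHe z hne, norm_div, div_le_iff₀ (by linarith)]
    calc ‖Φ z - Φ 1‖ ≤ ‖Φ z‖ + ‖Φ 1‖ := norm_sub_le _ _
      _ ≤ A + A := add_le_add (hA z hz) hA1
      _ ≤ 6 * A * ‖z - 1‖ := by nlinarith
  have hcauchy : ∀ m : ℕ, ‖iteratedDeriv m H 2‖ ≤ m.factorial * (6 * A) / (4 / 3) ^ m := fun m =>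
    Complex.norm_iteratedDeriv_le_of_forall_mem_sphere_norm_le m (by norm_num) hHd.diffContOnCl hbound
  have habs : LSeries.abscissaOfAbsConv a < ((2 : ℝ) : EReal) := by
    have : LSeries.abscissaOfAbsConv a ≤ ((1 : ℝ) : EReal) :=
      LSeries.abscissaOfAbsConv_le_of_forall_lt_LSeriesSummable fun y hy => hsum y (by simpa using hy)
    exact this.trans_lt (by exact_mod_cast one_lt_two)
  have hder : ∀ m : ℕ, (-1) ^ m * iteratedDeriv m H 2 =
      (-1) ^ m * iteratedDeriv m (LSeries a) 2 - m.factorial * Φ 1 := by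
    intro m
    have hev : H =ᶠ[nhds (2 : ℂ)] fun s => LSeries a s - Φ 1 * (fun d : ℂ => (1 * d - 1)⁻¹) s := by
      have : {s : ℂ | 1 < s.re} ∈ nhds (2 : ℂ) :=
        (isOpen_lt continuous_const Complex.continuous_re).mem_nhds (by simp)
      filter_upwards [this] with w hw
      have hw' : 1 < w.re := hw
      have hw1 : w ≠ 1 := by rintro rfl; simp at hw'
      have hw2 : w - 1 ≠ 0 := sub_ne_zero.2 hw1
      rw [hHe w hw1, hΦ w hw]
      simp only [one_mul]
      field_simp
    have hc1 : ContDiffAt ℂ m (LSeries a) 2 := by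
      refine ((LSeries_analyticOnNhd a) 2 ?_).contDiffAt
      simpa using habs
    have hc2 : ContDiffAt ℂ m (fun d : ℂ => (1 * d - 1)⁻¹) 2 := by
      refine ContDiffAt.inv (by fun_prop) (by norm_num)
    rw [hev.iteratedDeriv_eq, iteratedDeriv_fun_sub hc1 (contDiffAt_const.mul hc2),
      iteratedDeriv_const_mul_field, iteratedDeriv_eq_iterate (f := fun d : ℂ => (1 * d - 1)⁻¹),
      iter_deriv_inv_linear_sub]
    have h1 : (1 * (2 : ℂ) - 1) = 1 := by norm_num
    simp only [h1, one_zpow, one_pow, mul_one]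
    have h2 : ((-1 : ℂ) ^ m) * (-1) ^ m = 1 := by rw [← mul_pow]; simp
    linear_combination (-(m.factorial : ℂ) * Φ 1) * h2
  have hfac : ∀ m : ℕ, (0 : ℝ) < m.factorial := fun m => by exact_mod_cast m.factorial_pos
  set r : ℕ → ℝ := fun m => ((-1) ^ m * iteratedDeriv m H 2).re / m.factorial with hr
  have hx : ∀ m, r m = ((-1) ^ m * iteratedDeriv m (LSeries a) 2).re / m.factorial - (Φ 1).re := by
    intro m
    have h1 : ((m.factorial : ℂ) * Φ 1).re = m.factorial * (Φ 1).re := by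
      rw [← Complex.ofReal_natCast, Complex.re_ofReal_mul]
    simp only [hr]
    rw [hder m, Complex.sub_re, h1]
    have := (hfac m).ne'
    field_simp
  have hnn : ∀ m : ℕ, 0 ≤ ((-1) ^ m * iteratedDeriv m (LSeries a) 2).re := by
    intro m
    have := LSeries.iteratedDeriv_alternating ha habs m
    push_cast at this
    exact (Complex.le_def.1 this).1
  have hL2 : 1 ≤ (LSeries a 2).re := by
    have hs2 := hsum 2 (by norm_num)
    have h1 := Complex.hasSum_re hs2.hasSum
    have h2 := h1.summable.le_tsum 1 (fun j _ => by
      rw [LSeries.term_def]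
      split_ifs with hj
      · simp
      · have : (j : ℂ) ^ (2 : ℂ) = (((j : ℝ) ^ 2 : ℝ) : ℂ) := by
          rw [show (2 : ℂ) = ((2 : ℕ) : ℂ) by norm_num, Complex.cpow_natCast]; push_cast; rfl
        rw [this, Complex.div_ofReal_re]
        have h3 := (Complex.le_def.1 (ha j)).1
        simp only [Pi.zero_apply, Complex.zero_re] at h3
        positivity)
    rw [h1.tsum_eq] at h2
    rw [LSeries.term_of_ne_zero one_ne_zero] at h2
    simpa [ha1, LSeries] using h2
  have hx2 : (1 : ℝ) < 2 - β := by linarith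
  have htay : HasSum (fun m => r m * (2 - β) ^ m) (H β).re := by
    have h1 := Complex.hasSum_taylorSeries_on_ball (c := 2) (r := 2) (z := (β : ℂ)) (f := H)
      hHd.differentiableOn (by
        rw [Metric.mem_ball, dist_eq_norm]
        rw [show (β : ℂ) - 2 = ((β - 2 : ℝ) : ℂ) by push_cast; rfl, Complex.norm_real,
          Real.norm_eq_abs, abs_lt]
        constructor <;> linarith)
    have h2 := Complex.hasSum_re h1
    convert h2 using 1
    funext m
    have h3 : (β : ℂ) - 2 = ((-1 : ℂ)) * ((2 - β : ℝ) : ℂ) := by push_cast; ring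
    have h4 : ((m.factorial : ℂ)⁻¹ • ((β : ℂ) - 2) ^ m • iteratedDeriv m H 2) =
        ((((m.factorial : ℝ)⁻¹ * (2 - β) ^ m : ℝ)) : ℂ) * ((-1) ^ m * iteratedDeriv m H 2) := by
      rw [h3, mul_pow, smul_eq_mul, smul_eq_mul]; push_cast; ring
    rw [h4, Complex.re_ofReal_mul, hr]
    ring
  have hmain := real_taylor r (Φ 1).re (6 * A) (2 - β) (H β).re M hM1 hx2 (by linarith) (by linarith)
    ?_ ?_ ?_ htay hM
  · have hb1 : (β : ℂ) ≠ 1 := by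
      intro h; rw [← Complex.ofReal_one, Complex.ofReal_inj] at h; linarith
    have hHβ : (H β).re = ((Φ 1).re - (Φ β).re) / (1 - β) := by
      rw [hHe _ hb1, show (β : ℂ) - 1 = ((β - 1 : ℝ) : ℂ) by push_cast; rfl, Complex.div_ofReal_re,
        Complex.sub_re, ← neg_div_neg_eq]
      congr 1 <;> ring
    rw [hHβ, show (2 - β - 1) = 1 - β by ring] at hmain
    have h1b : 0 < 1 - β := by linarith
    have := mul_le_mul_of_nonneg_right hmain h1b.le
    rw [div_mul_cancel₀ _ h1b.ne', sub_mul, mul_assoc, div_mul_cancel₀ _ h1b.ne'] at this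
    linarith
  · rw [hx 0]; simp only [pow_zero, one_mul, iteratedDeriv_zero, Nat.factorial_zero, Nat.cast_one, div_one]
    linarith
  · intro m; rw [hx m]
    have := div_nonneg (hnn m) (hfac m).le
    linarith
  · intro m
    simp only [hr]
    rw [abs_div, abs_of_pos (hfac m), div_le_iff₀ (hfac m)]
    refine (Complex.abs_re_le_norm _).trans ?_
    rw [norm_mul, norm_pow, norm_neg, norm_one, one_pow, one_mul]
    refine (hcauchy m).trans (le_of_eq ?_)
    rw [div_eq_mul_inv, ← inv_pow]
    norm_num
    ring
end NSM

namespace NSM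
open Finset
open scoped ComplexOrder

noncomputable def Z1 : ℂ → ℂ := DirichletCharacter.LFunctionTrivChar₁ 1

lemma Z1_diff : Differentiable ℂ Z1 := DirichletCharacter.differentiable_LFunctionTrivChar₁ 1

lemma Z1_of_ne {s : ℂ} (hs : s ≠ 1) : Z1 s = (s - 1) * riemannZeta s := by
  simp [Z1, DirichletCharacter.LFunctionTrivChar₁, Function.update_of_ne hs,
    DirichletCharacter.LFunctionTrivChar]

lemma Z1_one : Z1 1 = 1 := by
  simp [Z1, DirichletCharacter.LFunctionTrivChar₁]

lemma Z1_bound : ∃ C : ℝ, 1 ≤ C ∧ ∀ s ∈ Metric.closedBall (2 : ℂ) (4 / 3), ‖Z1 s‖ ≤ C := by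
  obtain ⟨C, hC⟩ := (isCompact_closedBall (2 : ℂ) (4 / 3)).exists_bound_of_continuousOn
    Z1_diff.continuous.continuousOn
  exact ⟨max C 1, le_max_right _ _, fun s hs => (hC s hs).trans (le_max_left _ _)⟩

lemma Z1_pos : ∃ δ : ℝ, 0 < δ ∧ ∀ s : ℂ, ‖s - 1‖ < δ → 0 < (Z1 s).re := by
  have h : ∀ᶠ s in nhds (1 : ℂ), 0 < (Z1 s).re := by
    have hc : Continuous fun s => (Z1 s).re := Complex.continuous_re.comp Z1_diff.continuous
    exact hc.continuousAt.eventually (lt_mem_nhds (by simp [Z1_one]))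
  obtain ⟨δ, hδ, h⟩ := Metric.eventually_nhds_iff.1 h
  exact ⟨δ, hδ, fun s hs => h (by rwa [dist_eq_norm])⟩

lemma taylor_lower_q {K : ℝ} (hK : 1 ≤ K) : ∃ c : ℝ, 0 < c ∧ ∀ (q : ℕ), 3 ≤ q →
    ∀ (a : ℕ → ℂ) (Φ : ℂ → ℂ), 0 ≤ a → a 1 = 1 → (∀ s : ℂ, 1 < s.re → LSeriesSummable a s) →
    Differentiable ℂ Φ → (∀ s : ℂ, 1 < s.re → Φ s = (s - 1) * LSeries a s) →
    (∀ s ∈ Metric.closedBall (2 : ℂ) (4 / 3), ‖Φ s‖ ≤ K * q ^ 3) →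
    ∀ β : ℝ, 1 - 1 / (8 * Real.log q) ≤ β → β < 1 → 0 ≤ (Φ β).re →
    c * (1 - β) ≤ (Φ 1).re := by
  have hl0 : 0 ≤ Real.log (77 * K) := Real.log_nonneg (by linarith)
  set D := (32 / 5) * (Real.log (77 * K) + 3) with hD
  have hD0 : 0 < D := by positivity
  refine ⟨Real.exp (-(D + 1)) / 2, by positivity, ?_⟩
  intro q hq a Φ ha ha1 hsum hd hΦ hA β hβ hβ1 hβ0
  have hl := one_lt_log hq
  set l := Real.log q with hll
  set M := ⌈D * l⌉₊ with hM
  have hDl : 0 < D * l := by positivity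
  have hM1 : 1 ≤ M := Nat.ceil_pos.2 hDl
  have hMle : (M : ℝ) ≤ (D + 1) * l := by
    have := (Nat.ceil_lt_add_one hDl.le).le
    nlinarith
  have hMge : D * l ≤ M := Nat.le_ceil _
  have hq0 : (0 : ℝ) < q := by exact_mod_cast (by omega : 0 < q)
  have h18 : 1 / (8 * l) ≤ 1 / 8 := by
    apply one_div_le_one_div_of_le <;> linarith
  have key := taylor_lower ha ha1 hsum hd hΦ (A := K * q ^ 3) (M := M)
    (fun s hs => hA s (Metric.sphere_subset_closedBall hs)) (hA 1 (by
      simp only [Metric.mem_closedBall, dist_eq_norm]; norm_num)) (by linarith) hβ1 hβ0 hM1 (by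
      have h1 : ((27 : ℝ) / 32) ^ M ≤ Real.exp (-(5 / 32) * M) := by
        rw [mul_comm, Real.exp_nat_mul]
        gcongr
        linarith [Real.add_one_le_exp (-(5 / 32 : ℝ))]
      have h2 : Real.exp (-(5 / 32) * M) ≤ (77 * K * q ^ 3)⁻¹ := by
        rw [← Real.exp_log (show (0 : ℝ) < (77 * K * q ^ 3)⁻¹ by positivity), Real.exp_le_exp,
          Real.log_inv, Real.log_mul (by positivity) (by positivity), Real.log_pow]
        push_cast
        rw [← hll]
        nlinarith
      calc 6 * (K * q ^ 3) * (32 / 5) * ((27 : ℝ) / 32) ^ M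
          ≤ 6 * (K * q ^ 3) * (32 / 5) * (77 * K * q ^ 3)⁻¹ := by
            gcongr; exact h1.trans h2
        _ ≤ 1 / 2 := by field_simp; norm_num)
  have hpow : (2 - β) ^ M ≤ Real.exp (D + 1) := by
    calc (2 - β) ^ M ≤ Real.exp (1 - β) ^ M := by
          gcongr
          · linarith
          · linarith [Real.add_one_le_exp (1 - β)]
      _ = Real.exp (M * (1 - β)) := by rw [Real.exp_nat_mul]
      _ ≤ _ := by
          rw [Real.exp_le_exp]
          have h3 : 1 - β ≤ 1 / (8 * l) := by linarith
          have h4 : (D + 1) * l * (1 / (8 * l)) = (D + 1) / 8 := by field_simp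
          calc (M : ℝ) * (1 - β) ≤ (D + 1) * l * (1 / (8 * l)) := by
                gcongr
            _ ≤ D + 1 := by rw [h4]; linarith
  have hpos : 0 ≤ (Φ 1).re := by
    by_contra hneg
    push Not at hneg
    have : (Φ 1).re * (2 - β) ^ M ≤ 0 :=
      mul_nonpos_of_nonpos_of_nonneg hneg.le (pow_nonneg (by linarith) _)
    linarith
  have h5 : (1 - β) / 2 ≤ (Φ 1).re * Real.exp (D + 1) := key.trans (by gcongr)
  rw [Real.exp_neg]
  have := Real.exp_pos (D + 1)
  field_simp
  linarith

/-- The arithmetic function attached to a Dirichlet character. -/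
noncomputable def cA {q : ℕ} (χ : DirichletCharacter ℂ q) : ArithmeticFunction ℂ :=
  toArithmeticFunction (χ ·)

lemma cA_apply {q : ℕ} (χ : DirichletCharacter ℂ q) {n : ℕ} (hn : n ≠ 0) : cA χ n = χ n := by
  simp [cA, toArithmeticFunction, hn]

lemma cA_summable {q : ℕ} (χ : DirichletCharacter ℂ q) {s : ℂ} (hs : 1 < s.re) :
    LSeriesSummable (cA χ) s := by
  refine LSeriesSummable_of_bounded_of_one_lt_re (m := 1) (fun n hn ↦ ?_) hs
  rw [cA_apply χ hn]
  exact DirichletCharacter.norm_le_one χ _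

lemma LSeries_cA {q : ℕ} [NeZero q] (χ : DirichletCharacter ℂ q) {s : ℂ} (hs : 1 < s.re) :
    LSeries (cA χ) s = χ.LFunction s := by
  rw [χ.LFunction_eq_LSeries hs]
  exact LSeries_congr (fun {n} hn => cA_apply χ hn) s

lemma LSeries_zetaMul {q : ℕ} [NeZero q] (χ : DirichletCharacter ℂ q) {s : ℂ} (hs : 1 < s.re) :
    LSeries χ.zetaMul s = riemannZeta s * χ.LFunction s := by
  rw [DirichletCharacter.zetaMul]
  change LSeries (((ArithmeticFunction.zeta : ArithmeticFunction ℕ) : ArithmeticFunction ℂ) * cA χ : ArithmeticFunction ℂ) s = _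
  rw [ArithmeticFunction.LSeries_mul' _ (cA_summable χ hs), LSeries_cA χ hs]
  · congr 1
    exact ArithmeticFunction.LSeries_zeta_eq_riemannZeta hs
  · exact ArithmeticFunction.LSeriesSummable_zeta_iff.mpr hs

/-- The convolution of `1`, `χ1`, `χ2`, `χ1 χ2`. -/
noncomputable def four {q : ℕ} (χ1 χ2 : DirichletCharacter ℂ q) : ArithmeticFunction ℂ :=
  χ1.zetaMul * (cA χ2 * cA (χ1 * χ2))

lemma four_comm {q : ℕ} (χ1 χ2 : DirichletCharacter ℂ q) : four χ1 χ2 = four χ2 χ1 := by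
  rw [four, four, mul_comm χ2 χ1, DirichletCharacter.zetaMul, DirichletCharacter.zetaMul]
  change _ * cA χ1 * _ = _ * cA χ2 * _
  ring

lemma four_aux {q : ℕ} (χ1 χ2 : DirichletCharacter ℂ q) (n : ℕ) :
    (cA χ2 * cA (χ1 * χ2)) n = χ2 n * χ1.zetaMul n := by
  rw [DirichletCharacter.zetaMul]
  change _ = _ * (((ArithmeticFunction.zeta : ArithmeticFunction ℕ) : ArithmeticFunction ℂ) * cA χ1) n
  rw [ArithmeticFunction.mul_apply, ArithmeticFunction.mul_apply, mul_sum]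
  refine sum_congr rfl fun x hx => ?_
  obtain ⟨h1, h2⟩ := Nat.mem_divisorsAntidiagonal.1 hx
  have ha : x.1 ≠ 0 := by rintro h; simp [h] at h1; omega
  have hb : x.2 ≠ 0 := by rintro h; simp [h] at h1; omega
  rw [cA_apply _ ha, cA_apply _ hb, cA_apply _ hb, ← h1]
  simp [ha, MulChar.mul_apply]
  ring

lemma cA_mult {q : ℕ} (χ : DirichletCharacter ℂ q) : (cA χ).IsMultiplicative :=
  DirichletCharacter.isMultiplicative_toArithmeticFunction χ

lemma four_mult {q : ℕ} (χ1 χ2 : DirichletCharacter ℂ q) : (four χ1 χ2).IsMultiplicative :=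
  (χ1.isMultiplicative_zetaMul).mul ((cA_mult _).mul (cA_mult _))

lemma four_apply {q : ℕ} (χ1 χ2 : DirichletCharacter ℂ q) (n : ℕ) :
    four χ1 χ2 n = ∑ x ∈ n.divisorsAntidiagonal, χ1.zetaMul x.1 * (χ2 x.2 * χ1.zetaMul x.2) := by
  rw [four, ArithmeticFunction.mul_apply]
  simp_rw [four_aux]

lemma zetaMul_neg {q : ℕ} {χ : DirichletCharacter ℂ q} {p : ℕ} (hp : p.Prime) (h : χ p = -1)
    (k : ℕ) : χ.zetaMul (p ^ k) = if Even k then 1 else 0 := by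
  rw [DirichletCharacter.zetaMul]
  change (((ArithmeticFunction.zeta : ArithmeticFunction ℕ) : ArithmeticFunction ℂ) * cA χ) _ = _
  rw [ArithmeticFunction.coe_zeta_mul_apply, Nat.sum_divisors_prime_pow hp]
  have : ∀ i ∈ range (k + 1), cA χ (p ^ i) = (-1) ^ i := fun i _ => by
    rw [cA_apply _ (pow_ne_zero _ hp.ne_zero), Nat.cast_pow, map_pow, h]
  rw [sum_congr rfl this, neg_one_geom_sum]
  by_cases h : Even k <;> simp [h, Nat.even_add_one]

lemma four_pp {q : ℕ} {χ1 χ2 : DirichletCharacter ℂ q} (h1 : χ1 ^ 2 = 1) (h2 : χ2 ^ 2 = 1) {p : ℕ}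
    (hp : p.Prime) (k : ℕ) : 0 ≤ four χ1 χ2 (p ^ k) := by
  have hpw : ∀ x ∈ (p ^ k).divisorsAntidiagonal, ∃ j, x.2 = p ^ j := by
    intro x hx
    obtain ⟨h1, h2⟩ := Nat.mem_divisorsAntidiagonal.1 hx
    obtain ⟨j, -, hj⟩ := (Nat.dvd_prime_pow hp).1 (Dvd.intro_left _ h1)
    exact ⟨j, hj⟩
  have hmain : χ2 p = 0 ∨ χ2 p = 1 → 0 ≤ four χ1 χ2 (p ^ k) := by
    intro h
    rw [four_apply]
    refine sum_nonneg fun x hx => ?_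
    obtain ⟨j, hj⟩ := hpw x hx
    refine mul_nonneg (DirichletCharacter.zetaMul_nonneg h1 _)
      (mul_nonneg ?_ (DirichletCharacter.zetaMul_nonneg h1 _))
    rw [hj, Nat.cast_pow, map_pow]
    apply pow_nonneg
    rcases h with h | h <;> simp [h]
  rcases MulChar.isQuadratic_iff_sq_eq_one.mpr h2 p with h | h | h
  · exact hmain (Or.inl h)
  · exact hmain (Or.inr h)
  · rw [four_comm, four_apply]
    refine sum_nonneg fun x hx => ?_
    obtain ⟨j, hj⟩ := hpw x hx
    refine mul_nonneg (DirichletCharacter.zetaMul_nonneg h2 _) ?_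
    rw [hj, zetaMul_neg hp h]
    split_ifs with he
    · rw [Nat.cast_pow, map_pow, mul_one]
      obtain ⟨m, rfl⟩ := he
      rw [← two_mul, pow_mul]
      apply pow_nonneg
      rcases MulChar.isQuadratic_iff_sq_eq_one.mpr h1 p with h | h | h <;> simp [h]
    · simp

lemma four_nonneg {q : ℕ} {χ1 χ2 : DirichletCharacter ℂ q} (h1 : χ1 ^ 2 = 1) (h2 : χ2 ^ 2 = 1)
    (n : ℕ) : 0 ≤ four χ1 χ2 n := by
  rcases eq_or_ne n 0 with rfl | hn
  · simp only [ArithmeticFunction.map_zero, le_refl]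
  · rw [(four_mult χ1 χ2).multiplicative_factorization _ hn]
    exact Finset.prod_nonneg fun p hp ↦ four_pp h1 h2 (Nat.prime_of_mem_primeFactors hp) _

lemma four_summable {q : ℕ} (χ1 χ2 : DirichletCharacter ℂ q) {s : ℂ} (hs : 1 < s.re) :
    LSeriesSummable (four χ1 χ2) s :=
  ArithmeticFunction.LSeriesSummable_mul (χ1.LSeriesSummable_zetaMul hs)
    (ArithmeticFunction.LSeriesSummable_mul (cA_summable _ hs) (cA_summable _ hs))

lemma LSeries_four {q : ℕ} [NeZero q] (χ1 χ2 : DirichletCharacter ℂ q) {s : ℂ} (hs : 1 < s.re) :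
    LSeries (four χ1 χ2) s = riemannZeta s * χ1.LFunction s *
      (χ2.LFunction s * (χ1 * χ2).LFunction s) := by
  rw [four, ArithmeticFunction.LSeries_mul' (χ1.LSeriesSummable_zetaMul hs)
    (ArithmeticFunction.LSeriesSummable_mul (cA_summable _ hs) (cA_summable _ hs)),
    ArithmeticFunction.LSeries_mul' (cA_summable _ hs) (cA_summable _ hs), LSeries_zetaMul _ hs,
    LSeries_cA _ hs, LSeries_cA _ hs]

end NSM

namespace NSM
open Finset
open scoped ComplexOrder

lemma closedBall_facts {s : ℂ} (hs : s ∈ Metric.closedBall (2 : ℂ) (4 / 3)) :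
    1 / 2 ≤ s.re ∧ ‖s‖ ≤ 4 := by
  rw [Metric.mem_closedBall, dist_eq_norm] at hs
  have h1 := (abs_le.1 ((Complex.abs_re_le_norm (s - 2)).trans hs)).1
  have h2 : ‖s‖ ≤ ‖s - 2‖ + ‖(2 : ℂ)‖ := by simpa using norm_add_le (s - 2) 2
  simp at h1 h2
  constructor <;> linarith

lemma LB_real : ∃ c : ℝ, 0 < c ∧ ∀ (q : ℕ) [NeZero q], 3 ≤ q → ∀ χ : DirichletCharacter ℂ q,
    χ ≠ 1 → χ ^ 2 = 1 → ∀ β : ℝ, 1 - 1 / (8 * Real.log q) ≤ β → β < 1 →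
    0 ≤ (Z1 β * χ.LFunction β).re → c * (1 - β) ≤ ‖χ.LFunction 1‖ := by
  obtain ⟨C1, hC1, hb1⟩ := Z1_bound
  obtain ⟨C2, hC2, hb2⟩ := L_bound_q
  obtain ⟨c, hc, h⟩ := taylor_lower_q (K := C1 * C2) (by nlinarith)
  refine ⟨c, hc, fun q _ hq χ hχ h2 β hβ hβ1 hβ0 => ?_⟩
  have hq1 : (1 : ℝ) ≤ q := by exact_mod_cast (by omega : 1 ≤ q)
  have := h q hq χ.zetaMul (fun s => Z1 s * χ.LFunction s)
    (fun n => DirichletCharacter.zetaMul_nonneg h2 n) χ.isMultiplicative_zetaMul.map_one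
    (fun s hs => χ.LSeriesSummable_zetaMul hs)
    (Z1_diff.mul (DirichletCharacter.differentiable_LFunction hχ))
    (fun s hs => by
      have hs1 : s ≠ 1 := by rintro rfl; simp at hs
      rw [LSeries_zetaMul χ hs, Z1_of_ne hs1]; ring)
    (fun s hs => by
      obtain ⟨ha, hb⟩ := closedBall_facts hs
      rw [norm_mul]
      calc ‖Z1 s‖ * ‖χ.LFunction s‖ ≤ C1 * (C2 * q) := by
            gcongr
            · exact hb1 s hs
            · exact hb2 q χ hχ s ha hb
        _ ≤ C1 * C2 * q ^ 3 := by
            rw [← mul_assoc]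
            gcongr
            exact le_self_pow₀ hq1 (by norm_num)) β hβ hβ1 hβ0
  refine this.trans ?_
  simp only [Z1_one, one_mul]
  exact Complex.re_le_norm _

lemma LB_four : ∃ c : ℝ, 0 < c ∧ ∀ (q : ℕ) [NeZero q], 3 ≤ q → ∀ χ1 χ2 : DirichletCharacter ℂ q,
    χ1 ≠ 1 → χ1 ^ 2 = 1 → χ2 ≠ 1 → χ2 ^ 2 = 1 → χ1 ≠ χ2 →
    ∀ β : ℝ, 1 - 1 / (8 * Real.log q) ≤ β → β < 1 →
    χ1.LFunction β = 0 → c * (1 - β) ≤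
      ‖χ1.LFunction 1‖ * (‖χ2.LFunction 1‖ * ‖(χ1 * χ2).LFunction 1‖) := by
  obtain ⟨C1, hC1, hb1⟩ := Z1_bound
  obtain ⟨C2, hC2, hb2⟩ := L_bound_q
  obtain ⟨c, hc, h⟩ := taylor_lower_q (K := C1 * C2 ^ 3) (one_le_mul_of_one_le_of_one_le hC1 (one_le_pow₀ hC2))
  refine ⟨c, hc, fun q _ hq χ1 χ2 hχ1 h1 hχ2 h2 hne β hβ hβ1 hβ0 => ?_⟩
  have hq1 : (1 : ℝ) ≤ q := by exact_mod_cast (by omega : 1 ≤ q)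
  have hχ12 : χ1 * χ2 ≠ 1 := by
    intro h12
    apply hne
    have : χ1 * χ2 * χ2 = χ2 := by rw [h12, one_mul]
    rwa [mul_assoc, ← sq, h2, mul_one] at this
  have := h q hq (four χ1 χ2)
    (fun s => Z1 s * χ1.LFunction s * (χ2.LFunction s * (χ1 * χ2).LFunction s))
    (fun n => four_nonneg h1 h2 n) (four_mult χ1 χ2).map_one
    (fun s hs => four_summable χ1 χ2 hs)
    ((Z1_diff.mul (DirichletCharacter.differentiable_LFunction hχ1)).mul
      ((DirichletCharacter.differentiable_LFunction hχ2).mul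
        (DirichletCharacter.differentiable_LFunction hχ12)))
    (fun s hs => by
      have hs1 : s ≠ 1 := by rintro rfl; simp at hs
      rw [LSeries_four χ1 χ2 hs, Z1_of_ne hs1]; ring)
    (fun s hs => by
      obtain ⟨ha, hb⟩ := closedBall_facts hs
      rw [norm_mul, norm_mul, norm_mul]
      calc ‖Z1 s‖ * ‖χ1.LFunction s‖ * (‖χ2.LFunction s‖ * ‖(χ1 * χ2).LFunction s‖)
          ≤ C1 * (C2 * q) * ((C2 * q) * (C2 * q)) := by
            have := hb2 q χ1 hχ1 s ha hb
            have := hb2 q χ2 hχ2 s ha hb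
            have := hb2 q (χ1 * χ2) hχ12 s ha hb
            have := hb1 s hs
            gcongr
        _ = C1 * C2 ^ 3 * q ^ 3 := by ring) β hβ hβ1 (by simp [hβ0])
  refine this.trans ((Complex.re_le_norm _).trans ?_)
  simp [Z1_one]

lemma zeta_bound : ∃ C : ℝ, 1 ≤ C ∧ ∀ (q : ℕ) [NeZero q] (x : ℝ), 0 < x → x ≤ 1 →
    ‖DirichletCharacter.LFunctionTrivChar q (1 + x)‖ ≤ C / x := by
  obtain ⟨C, hC, hb⟩ := Z1_bound
  refine ⟨C, hC, fun q _ x hx hx1 => ?_⟩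
  have hs : 1 < ((1 : ℂ) + x).re := by simpa using hx
  have hs1 : (1 : ℂ) + x ≠ 1 := by simpa using hx.ne'
  have h1 : ‖riemannZeta (1 + x)‖ ≤ C / x := by
    have := hb (1 + x) (by
      rw [Metric.mem_closedBall, dist_eq_norm]
      have : (1 : ℂ) + x - 2 = ((x - 1 : ℝ) : ℂ) := by push_cast; ring
      rw [this, Complex.norm_real, Real.norm_eq_abs, abs_le]; constructor <;> linarith)
    rw [Z1_of_ne hs1, norm_mul, add_sub_cancel_left, Complex.norm_real, Real.norm_eq_abs,
      abs_of_pos hx] at this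
    rw [le_div_iff₀ hx]; linarith
  rw [DirichletCharacter.LFunctionTrivChar_eq_mul_riemannZeta hs1, norm_mul]
  refine (mul_le_of_le_one_left (norm_nonneg _) ?_).trans h1
  rw [norm_prod]
  refine prod_le_one (fun _ _ => norm_nonneg _) fun p hp => ?_
  have hp := Nat.prime_of_mem_primeFactors hp
  have hp0 : (0:ℝ) < p := by exact_mod_cast hp.pos
  have : (1 : ℂ) - (p : ℂ) ^ (-(1 + (x : ℂ))) = ((1 - (p : ℝ) ^ (-(1 + x)) : ℝ) : ℂ) := by
    push_cast [Complex.ofReal_cpow hp0.le]; simp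
  rw [this, Complex.norm_real, Real.norm_eq_abs, abs_le]
  have h2 : 0 < (p : ℝ) ^ (-(1 + x)) := by positivity
  have h3 : (p : ℝ) ^ (-(1 + x)) ≤ 1 := by
    apply Real.rpow_le_one_of_one_le_of_nonpos
    · exact_mod_cast hp.one_le
    · linarith
  constructor <;> linarith

end NSM

namespace NSM
open Finset

lemma LB_complex : ∃ c : ℝ, 0 < c ∧ ∀ (q : ℕ) [NeZero q], 3 ≤ q → ∀ χ : DirichletCharacter ℂ q,
    χ ≠ 1 → χ ^ 2 ≠ 1 → c / Real.log q ^ 7 ≤ ‖χ.LFunction 1‖ := by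
  obtain ⟨C1, hC1, hb1⟩ := L_near_one
  obtain ⟨C2, hC2, hb2⟩ := zeta_bound
  set Q := C2 ^ 3 * (1 + C1) ^ 4 * C1 with hQ
  have hQ1 : 1 ≤ Q := by
    have := one_le_pow₀ hC2 (n := 3)
    have := one_le_pow₀ (show 1 ≤ 1 + C1 by linarith) (n := 4)
    exact one_le_mul_of_one_le_of_one_le (one_le_mul_of_one_le_of_one_le (by assumption)
      (by assumption)) hC1
  set η := 1 / (4 * Q) with hη
  have hη0 : 0 < η := by positivity
  have hη4 : η ≤ 1 / 4 := by
    apply one_div_le_one_div_of_le <;> linarith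
  refine ⟨η, hη0, fun q _ hq χ hχ h2 => ?_⟩
  by_contra hcon
  push Not at hcon
  have hl := one_lt_log hq
  set l := Real.log q with hll
  have hl0 : 0 < l := by linarith
  set x := η / l ^ 9 with hx
  have hx0 : 0 < x := by positivity
  have hxl : x ≤ 1 / (4 * l) := by
    rw [hx]
    calc η / l ^ 9 ≤ (1 / 4) / l := by
          gcongr
          exact le_self_pow₀ hl.le (by norm_num)
      _ = _ := by field_simp
  have hxl2 : x < 1 / (2 * l) := by
    refine hxl.trans_lt (one_div_lt_one_div_of_lt ?_ ?_) <;> linarith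
  have hx1 : x ≤ 1 := hxl.trans (by rw [div_le_one] <;> linarith)
  have hn : ‖(1 : ℂ) + x - 1‖ = x := by
    rw [add_sub_cancel_left, Complex.norm_real, Real.norm_eq_abs, abs_of_pos hx0]
  have hp := DirichletCharacter.norm_LFunction_product_ge_one (N := q) χ hx0 0
  simp only [Complex.ofReal_zero, mul_zero, add_zero, norm_mul, norm_pow] at hp
  have e1 := hb2 q x hx0 hx1
  have e2 := (hb1 q hq χ hχ (1 + x) (by rw [hn]; exact hxl2)).2
  have e3 := (hb1 q hq (χ ^ 2) h2 (1 + x) (by rw [hn]; exact hxl2)).1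
  rw [hn] at e2
  have e4 : ‖χ.LFunction (1 + x)‖ ≤ (1 + C1) * η / l ^ 7 := by
    have : ‖χ.LFunction (1 + x)‖ ≤ ‖χ.LFunction (1 + x) - χ.LFunction 1‖ + ‖χ.LFunction 1‖ := by
      simpa using norm_add_le (χ.LFunction (1 + x) - χ.LFunction 1) (χ.LFunction 1)
    have h7 : C1 * l ^ 2 * x = C1 * η / l ^ 7 := by rw [hx]; field_simp
    have : (1 + C1) * η / l ^ 7 = η / l ^ 7 + C1 * η / l ^ 7 := by ring
    linarith
  have : (1 : ℝ) ≤ (C2 / x) ^ 3 * ((1 + C1) * η / l ^ 7) ^ 4 * (C1 * l) := by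
    refine hp.le.trans ?_
    gcongr
  have h8 : (C2 / x) ^ 3 * ((1 + C1) * η / l ^ 7) ^ 4 * (C1 * l) = Q * η := by
    rw [hx, hQ]; field_simp
  rw [h8, hη] at this
  have h9 : Q * (1 / (4 * Q)) = 1 / 4 := by field_simp
  rw [h9] at this
  norm_num at this

lemma re_pos_of_no_zero {q : ℕ} [NeZero q] {χ : DirichletCharacter ℂ q} (hχ : χ ≠ 1)
    (h2 : χ ^ 2 = 1) {β : ℝ} (hβ : 0 < β) (hz : ∀ σ : ℝ, β ≤ σ → χ.LFunction σ ≠ 0) :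
    0 < (χ.LFunction β).re := by
  by_contra hcon
  push Not at hcon
  have ht : Filter.Tendsto (fun x : ℝ => LSeries (χ ·) x) Filter.atTop (nhds (χ (1 : ℕ))) := by
    apply LSeries.tendsto_atTop
    exact lt_of_le_of_lt (LSeries.abscissaOfAbsConv_le_of_forall_lt_LSeriesSummable
      (x := 1) fun y hy => ZMod.LSeriesSummable_of_one_lt_re χ (by simpa using hy)) (EReal.coe_lt_top 1)
  have ht2 := (Complex.continuous_re.tendsto _).comp ht
  have h3 : ∀ᶠ x : ℝ in Filter.atTop, 0 < (LSeries (χ ·) x).re :=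
    ht2.eventually (lt_mem_nhds (by simp))
  obtain ⟨σ, hσ, hσ1⟩ := (h3.and (Filter.eventually_gt_atTop (max 1 β))).exists
  have hσ2 : 1 < σ := (le_max_left _ _).trans_lt hσ1
  have hσ3 : β < σ := (le_max_right _ _).trans_lt hσ1
  rw [← χ.LFunction_eq_LSeries (by simpa using hσ2)] at hσ
  have hc : Continuous fun x : ℝ => (χ.LFunction x).re :=
    Complex.continuous_re.comp
      ((DirichletCharacter.differentiable_LFunction hχ).continuous.comp Complex.continuous_ofReal)
  obtain ⟨y, hy, hy0⟩ := intermediate_value_Icc hσ3.le hc.continuousOn ⟨hcon, hσ.le⟩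
  apply hz y hy.1
  apply Complex.ext
  · simpa using hy0
  · simpa using L_real hχ h2 (hβ.trans_le hy.1)

lemma LB : ∃ c : ℝ, 0 < c ∧ ∃ c0 : ℝ, 0 < c0 ∧ ∀ (q : ℕ) [NeZero q], 3 ≤ q →
    ((∀ χ : DirichletCharacter ℂ q, χ ≠ 1 → ∀ β : ℝ,
          1 - c0 / Real.log q ≤ β → χ.LFunction (β : ℂ) ≠ 0) →
      ∀ χ : DirichletCharacter ℂ q, χ ≠ 1 → c / Real.log q ^ 7 ≤ ‖χ.LFunction 1‖) ∧
    (∀ (χ1 : DirichletCharacter ℂ q) (β1 : ℝ),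
          χ1 ≠ 1 → (∀ a : ZMod q, (starRingEnd ℂ) (χ1 a) = χ1 a) →
          χ1.LFunction (β1 : ℂ) = 0 → 1 - c0 / Real.log q ≤ β1 →
      β1 < 1 ∧ c * (1 - β1) ≤ ‖χ1.LFunction 1‖ ∧
      ∀ χ : DirichletCharacter ℂ q, χ ≠ 1 → χ ≠ χ1 → c / Real.log q ^ 7 ≤ ‖χ.LFunction 1‖) := by
  obtain ⟨ca, hca, ha⟩ := LB_complex
  obtain ⟨cb, hcb, hb⟩ := LB_real
  obtain ⟨cf, hcf, hf⟩ := LB_four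
  obtain ⟨C1, hC1, hn⟩ := L_near_one
  obtain ⟨δ, hδ, hZ⟩ := Z1_pos
  set c0 := min (1 / 8) (δ / 2) with hc0
  have hc00 : 0 < c0 := by positivity
  have hc08 : c0 ≤ 1 / 8 := min_le_left _ _
  have hc0δ : c0 < δ := (min_le_right _ _).trans_lt (by linarith)
  set c := min (min ca cb) (min (cb * c0) (cf / C1 ^ 2)) with hc
  have hcpos : 0 < c := by positivity
  have g1 : c ≤ ca := (min_le_left _ _).trans (min_le_left _ _)
  have g2 : c ≤ cb := (min_le_left _ _).trans (min_le_right _ _)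
  have g3 : c ≤ cb * c0 := (min_le_right _ _).trans (min_le_left _ _)
  have g4 : c ≤ cf / C1 ^ 2 := (min_le_right _ _).trans (min_le_right _ _)
  refine ⟨c, hcpos, c0, hc00, fun q _ hq => ?_⟩
  have hl := one_lt_log hq
  have hq8 : c0 / Real.log q ≤ 1 / (8 * Real.log q) := by
    calc c0 / Real.log q ≤ (1 / 8) / Real.log q := by gcongr
      _ = _ := by field_simp
  have hq9 : c0 / Real.log q ≤ c0 := div_le_self hc00.le hl.le
  have hq10 : 0 < c0 / Real.log q := by positivity
  set l := Real.log q with hll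
  have hcomplex : ∀ χ : DirichletCharacter ℂ q, χ ≠ 1 → χ ^ 2 ≠ 1 →
      c / l ^ 7 ≤ ‖χ.LFunction 1‖ := fun χ hχ h2 =>
    le_trans (by gcongr) (ha q hq χ hχ h2)
  constructor
  · intro hz χ hχ
    by_cases h2 : χ ^ 2 = 1
    · have hβ0 : 0 < 1 - c0 / l := by linarith
      have hre := re_pos_of_no_zero hχ h2 hβ0 (fun σ hσ => hz χ hχ σ hσ)
      have him := L_real hχ h2 hβ0
      have hZp := hZ ((1 - c0 / l : ℝ) : ℂ) (by
        have : (((1 - c0 / l : ℝ) : ℂ) - 1) = ((-(c0 / l) : ℝ) : ℂ) := by push_cast; ring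
        rw [this, Complex.norm_real, norm_neg, Real.norm_eq_abs, abs_of_pos hq10]
        linarith)
      have := hb q hq χ hχ h2 (1 - c0 / l) (by linarith) (by linarith) (by
        rw [Complex.mul_re, him, mul_zero, sub_zero]
        positivity)
      refine le_trans ?_ this
      calc c / l ^ 7 ≤ cb * c0 / l := by
            gcongr
            exact le_self_pow₀ hl.le (by norm_num)
        _ = _ := by ring
    · exact hcomplex χ hχ h2
  · intro χ1 β1 hχ1 hr hz hβ
    have hβ1 : β1 < 1 := by
      by_contra hge
      push Not at hge
      exact DirichletCharacter.LFunction_ne_zero_of_one_le_re χ1 (Or.inl hχ1) (by simpa using hge) hz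
    have h12 : χ1 ^ 2 = 1 := by
      ext a
      rw [MulChar.pow_apply_coe, MulChar.one_apply_coe]
      have h1 := hr a
      have h2 : ‖χ1 a‖ = 1 := DirichletCharacter.unit_norm_eq_one χ1 a
      have h3 := Complex.mul_conj' (χ1 a)
      rw [h1, h2] at h3
      rw [sq, h3]; simp
    refine ⟨hβ1, ?_, ?_⟩
    · refine le_trans ?_ (hb q hq χ1 hχ1 h12 β1 (by linarith) hβ1 (by simp [hz]))
      gcongr
    · intro χ hχ hne
      by_cases h2 : χ ^ 2 = 1
      · have hχ12 : χ1 * χ ≠ 1 := by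
          intro h12
          apply hne.symm
          have : χ1 * χ * χ = χ := by rw [h12, one_mul]
          rwa [mul_assoc, ← sq, h2, mul_one] at this
        have e1 := hf q hq χ1 χ hχ1 h12 hχ h2 hne.symm β1 (by linarith) hβ1 hz
        have hnorm : ‖(β1 : ℂ) - 1‖ = 1 - β1 := by
          have : (β1 : ℂ) - 1 = ((β1 - 1 : ℝ) : ℂ) := by push_cast; ring
          rw [this, Complex.norm_real, Real.norm_eq_abs, abs_of_neg (by linarith)]; ring
        have e2 := (hn q hq χ1 hχ1 β1 (by
          rw [hnorm]
          have : 1 / (8 * l) < 1 / (2 * l) := by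
            apply one_div_lt_one_div_of_lt <;> linarith
          linarith)).2
        rw [hz, zero_sub, norm_neg, hnorm] at e2
        have e3 := (hn q hq (χ1 * χ) hχ12 1 (by simp; positivity)).1
        have e4 : cf * (1 - β1) ≤ C1 * l ^ 2 * (1 - β1) * (‖χ.LFunction 1‖ * (C1 * l)) :=
          e1.trans (by gcongr)
        have e5 : cf ≤ C1 ^ 2 * l ^ 3 * ‖χ.LFunction 1‖ := by
          have hpos : 0 < 1 - β1 := by linarith
          refine le_of_mul_le_mul_right (e4.trans (le_of_eq ?_)) hpos
          ring
        have e6 : cf / C1 ^ 2 / l ^ 3 ≤ ‖χ.LFunction 1‖ := by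
          rw [div_div, div_le_iff₀ (by positivity)]; linarith
        refine le_trans ?_ e6
        gcongr
        · exact hl.le
        · norm_num
      · exact hcomplex χ hχ h2

end NSM

namespace NSM
open Finset

/-- `log q / log log q`. -/
noncomputable def TT (q : ℕ) : ℝ := Real.log q / Real.log (Real.log q)

lemma loglog_pos {q : ℕ} (hq : 3 ≤ q) : 0 < Real.log (Real.log q) := Real.log_pos (one_lt_log hq)

lemma one_le_TT {q : ℕ} (hq : 3 ≤ q) : 1 ≤ TT q := by
  rw [TT, le_div_iff₀ (loglog_pos hq), one_mul]
  exact Real.log_le_self (by linarith [one_lt_log hq])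

lemma loglog_le_TT {q : ℕ} (hq : 3 ≤ q) : Real.log (Real.log q) ≤ 4 * TT q := by
  have hy := loglog_pos hq
  have hl := one_lt_log hq
  rw [TT, ← mul_div_assoc, le_div_iff₀ hy]
  set y := Real.log (Real.log q) with hyy
  have h1 : y / 2 ≤ Real.exp (y / 2) := by linarith [Real.add_one_le_exp (y / 2)]
  have h2 : Real.log q = Real.exp (y / 2) * Real.exp (y / 2) := by
    rw [← Real.exp_add, add_halves, hyy, Real.exp_log (by linarith)]
  rw [h2]
  nlinarith

lemma log_pow_le {q : ℕ} (hq : 3 ≤ q) (k : ℕ) : Real.log q ^ k ≤ Real.exp (4 * k * TT q) := by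
  have h1 : Real.log q ≤ Real.exp (4 * TT q) := by
    rw [← Real.log_le_iff_le_exp (by linarith [one_lt_log hq])]
    exact loglog_le_TT hq
  calc Real.log q ^ k ≤ Real.exp (4 * TT q) ^ k := by
        gcongr
    _ = _ := by rw [← Real.exp_nat_mul]; ring_nf

lemma const_le {q : ℕ} (hq : 3 ≤ q) {K : ℝ} (hK : 1 ≤ K) : K ≤ Real.exp (Real.log K * TT q) := by
  calc K = Real.exp (Real.log K) := (Real.exp_log (by linarith)).symm
    _ ≤ _ := Real.exp_le_exp.2 (le_mul_of_one_le_right (Real.log_nonneg hK) (one_le_TT hq))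

lemma divisor_bound {q : ℕ} (hq : 3 ≤ q) {n : ℕ} (hn : n ≠ 0) (hnq : n ≤ q ^ 6) :
    (n.divisors.card : ℝ) ≤ Real.exp (26 * TT q) := by
  have hy := loglog_pos hq
  have hl := one_lt_log hq
  have hl2 : Real.log q = Real.exp (Real.log (Real.log q)) := (Real.exp_log (by linarith)).symm
  set l := Real.log q with hll
  set y := Real.log l with hyy
  have hT : TT q = l / y := rfl
  set t := Real.exp (y / 2) with ht
  have htt : t * t = l := by rw [ht, ← Real.exp_add, add_halves, ← hl2]
  have ht1 : 1 ≤ t := Real.one_le_exp (by positivity)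
  have hlogn : Real.log n ≤ 6 * l := by
    have : Real.log n ≤ Real.log ((q : ℝ) ^ 6) := by
      apply Real.log_le_log
      · exact_mod_cast Nat.pos_of_ne_zero hn
      · exact_mod_cast hnq
    rwa [Real.log_pow] at this
  have hsum : ∑ p ∈ n.primeFactors, (n.factorization p : ℝ) * Real.log p = Real.log n := by
    rw [Real.log_nat_eq_sum_factorization]
    rfl
  rw [← Real.log_le_iff_le_exp (by
    have : 0 < n.divisors.card := Finset.card_pos.2 ⟨1, by simp [hn]⟩
    exact_mod_cast this), Nat.card_divisors hn]
  push_cast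
  rw [Real.log_prod (fun p _ => by positivity)]
  have hterm : ∀ p ∈ n.primeFactors, Real.log ((n.factorization p : ℝ) + 1) ≤
      (if (p : ℝ) ≤ t then 3 + y else 0) + (2 / y) * ((n.factorization p : ℝ) * Real.log p) := by
    intro p hp
    have hpp := Nat.prime_of_mem_primeFactors hp
    have hp2 : (2 : ℝ) ≤ p := by exact_mod_cast hpp.two_le
    have hlp : Real.log 2 ≤ Real.log p := Real.log_le_log (by norm_num) hp2
    have hl2 := Real.log_two_gt_d9
    have hl2' := Real.log_two_lt_d9
    have he0 : (0 : ℝ) ≤ n.factorization p := by positivity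
    split_ifs with hpt
    · have h1 : (n.factorization p : ℝ) * Real.log p ≤ 6 * l := by
        refine le_trans ?_ hlogn
        rw [← hsum]
        exact single_le_sum (f := fun p => (n.factorization p : ℝ) * Real.log p) (fun i hi => by
          have := Nat.prime_of_mem_primeFactors hi
          have : (1 : ℝ) ≤ i := by exact_mod_cast this.one_le
          have := Real.log_nonneg this
          positivity) hp
      have h2 : (n.factorization p : ℝ) + 1 ≤ 11 * l := by nlinarith
      have h3 : Real.log ((n.factorization p : ℝ) + 1) ≤ Real.log 11 + y := by
        rw [hyy, ← Real.log_mul (by norm_num) (by linarith)]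
        exact Real.log_le_log (by positivity) h2
      have h4 : Real.log 11 ≤ 3 := by
        rw [Real.log_le_iff_le_exp (by norm_num)]
        have := Real.exp_one_gt_d9
        have h5 : Real.exp 3 = Real.exp 1 ^ 3 := by rw [← Real.exp_nat_mul]; norm_num
        rw [h5]
        calc (11 : ℝ) ≤ 2.7 ^ 3 := by norm_num
          _ ≤ _ := by gcongr; linarith
      have : 0 ≤ (2 / y) * ((n.factorization p : ℝ) * Real.log p) := by
        have : 0 ≤ Real.log p := by linarith
        positivity
      linarith
    · push Not at hpt
      have h1 : y / 2 ≤ Real.log p := by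
        rw [Real.le_log_iff_exp_le (by linarith)]; exact hpt.le
      have h2 : Real.log ((n.factorization p : ℝ) + 1) ≤ n.factorization p := by
        have := Real.log_le_sub_one_of_pos (show 0 < (n.factorization p : ℝ) + 1 by positivity)
        linarith
      rw [zero_add]
      refine h2.trans ?_
      have : 1 ≤ (2 / y) * Real.log p := by
        rw [div_mul_eq_mul_div, le_div_iff₀ hy]; linarith
      nlinarith
  refine (sum_le_sum hterm).trans ?_
  rw [sum_add_distrib, ← mul_sum, hsum, ← sum_filter, sum_const, nsmul_eq_mul]
  have hcard : ((n.primeFactors.filter fun p : ℕ => (p : ℝ) ≤ t).card : ℝ) ≤ t := by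
    have : (n.primeFactors.filter fun p : ℕ => (p : ℝ) ≤ t) ⊆ Finset.Icc 1 ⌊t⌋₊ := by
      intro p hp
      rw [mem_filter] at hp
      rw [mem_Icc]
      exact ⟨(Nat.prime_of_mem_primeFactors hp.1).one_le, Nat.le_floor hp.2⟩
    have := card_le_card this
    rw [Nat.card_Icc, Nat.add_sub_cancel] at this
    calc ((n.primeFactors.filter fun p : ℕ => (p : ℝ) ≤ t).card : ℝ) ≤ ⌊t⌋₊ := by exact_mod_cast this
      _ ≤ t := Nat.floor_le (by linarith)
  have h1 : (2 / y) * Real.log n ≤ 12 * TT q := by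
    rw [hT]
    calc (2 / y) * Real.log n ≤ (2 / y) * (6 * l) := by gcongr
      _ = _ := by ring
  have h2 : t * (3 + y) ≤ 14 * TT q := by
    rw [hT, ← mul_div_assoc, le_div_iff₀ hy, ← htt]
    have h3 : (y / 2) + 1 ≤ t := Real.add_one_le_exp _
    have h4 : (y / 2) ^ 2 / 2 ≤ t := by
      have := Real.quadratic_le_exp_of_nonneg (show 0 ≤ y / 2 by positivity)
      linarith
    have h5 : (3 + y) * y ≤ 14 * t := by nlinarith
    nlinarith
  have h3 : ((n.primeFactors.filter fun p : ℕ => (p : ℝ) ≤ t).card : ℝ) * (3 + y) ≤ t * (3 + y) := by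
    gcongr
  linarith

end NSM

namespace NSM
open Finset

lemma conj_char {q : ℕ} [NeZero q] (χ : DirichletCharacter ℂ q) {a : ZMod q} (ha : IsUnit a) :
    (starRingEnd ℂ) (χ a) = χ a⁻¹ := by
  have h0 : χ a ≠ 0 := (ha.map χ).ne_zero
  apply mul_left_cancel₀ h0
  rw [← map_mul, ZMod.mul_inv_of_unit a ha, map_one, Complex.mul_conj']
  obtain ⟨u, rfl⟩ := ha
  rw [DirichletCharacter.unit_norm_eq_one χ u]
  norm_num

open scoped Classical in
lemma even_orth {q : ℕ} [NeZero q] (a b : ZMod q) :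
    (∑ χ : DirichletCharacter ℂ q, if χ.Even then χ b * (starRingEnd ℂ) (χ a) else 0) =
      if IsUnit a then (q.totient : ℂ) / 2 *
        ((if a = b then 1 else 0) + (if a = -b then 1 else 0)) else 0 := by
  by_cases ha : IsUnit a
  · rw [if_pos ha]
    have h1 : ∀ χ : DirichletCharacter ℂ q,
        (if χ.Even then χ b * (starRingEnd ℂ) (χ a) else 0) =
        (1 / 2) * (χ a⁻¹ * χ b) + (1 / 2) * (χ a⁻¹ * χ (-b)) := by
      intro χ
      rw [conj_char χ ha]
      split_ifs with he
      · rw [he.eval_neg]; ring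
      · rcases χ.even_or_odd with h | h
        · exact absurd h he
        · rw [h.eval_neg]; ring
    rw [sum_congr rfl fun χ _ => h1 χ, sum_add_distrib, ← mul_sum, ← mul_sum,
      DirichletCharacter.sum_char_inv_mul_char_eq ℂ ha b,
      DirichletCharacter.sum_char_inv_mul_char_eq ℂ ha (-b)]
    split_ifs <;> ring
  · rw [if_neg ha]
    apply sum_eq_zero
    intro χ _
    rw [MulChar.map_nonunit χ ha]
    simp

/-- Harmonic number up to `2 R`. -/
noncomputable def HH (R : ℕ) : ℝ := ∑ k ∈ Icc 1 (2 * R), ((k : ℝ))⁻¹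

lemma HH_nonneg (R : ℕ) : 0 ≤ HH R := sum_nonneg fun _ _ => by positivity

lemma sum_le_HH {R X : ℕ} (h : X ≤ 2 * R) : ∑ k ∈ Icc 1 X, ((k : ℝ))⁻¹ ≤ HH R :=
  sum_le_sum_of_subset_of_nonneg (Icc_subset_Icc_right h) fun _ _ _ => by positivity

lemma one_le_HH {R : ℕ} (hR : 1 ≤ R) : 1 ≤ HH R := by
  have := sum_le_HH (R := R) (X := 1) (by omega)
  simpa using this

lemma HH_le {q : ℕ} (hq : 3 ≤ q) : HH (q ^ 6) ≤ 8 * Real.log q := by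
  have hl := one_lt_log hq
  have h1 : HH (q ^ 6) = ∑ n ∈ range (2 * q ^ 6), (((n + 1 : ℕ) : ℝ))⁻¹ := by
    rw [HH, range_eq_Ico, Finset.sum_Ico_add' (fun k : ℕ => ((k : ℝ))⁻¹) 0 (2 * q ^ 6) 1]
    rfl
  rw [h1]
  refine (sum_inv_le_log _).trans ?_
  push_cast
  rw [Real.log_mul (by norm_num) (by positivity), Real.log_pow]
  have := Real.log_two_lt_d9
  push_cast
  linarith

lemma arith_sum {q : ℕ} [NeZero q] {R : ℕ} (s : Finset ℕ)
    (hs : ∀ v ∈ s, 0 < v ∧ v ≤ 2 * R ∧ q ∣ v) : ∑ v ∈ s, ((v : ℝ))⁻¹ ≤ HH R / q := by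
  have hq : 0 < q := NeZero.pos q
  have hsub : s ⊆ (Icc 1 (2 * R)).image (fun k => q * k) := by
    intro v hv
    obtain ⟨h1, h2, k, rfl⟩ := hs v hv
    refine mem_image.2 ⟨k, mem_Icc.2 ⟨Nat.pos_of_mul_pos_left h1, ?_⟩, rfl⟩
    exact le_trans (Nat.le_mul_of_pos_left k hq) h2
  refine (sum_le_sum_of_subset_of_nonneg hsub fun _ _ _ => by positivity).trans ?_
  rw [sum_image (fun a _ b _ h => Nat.eq_of_mul_eq_mul_left hq h), HH, sum_div]
  refine le_of_eq (sum_congr rfl fun k _ => ?_)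
  push_cast
  rw [mul_inv]; ring

lemma arith_sum_inj {q : ℕ} [NeZero q] {R : ℕ} (s : Finset ℕ) (g : ℕ → ℕ) (hg : Set.InjOn g s)
    (hs : ∀ v ∈ s, 0 < g v ∧ g v ≤ 2 * R ∧ q ∣ g v) : ∑ v ∈ s, ((g v : ℝ))⁻¹ ≤ HH R / q := by
  rw [← sum_image (f := fun v : ℕ => ((v : ℝ))⁻¹) hg]
  apply arith_sum
  intro v hv
  obtain ⟨w, hw, rfl⟩ := mem_image.1 hv
  exact hs w hw

lemma off_lt {q : ℕ} [NeZero q] (R : ℕ) :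
    ∑ n ∈ Icc 1 R, ∑ m ∈ Icc 1 R, (if n < m ∧ (n : ZMod q) = m then ((n : ℝ) * m)⁻¹ else 0)
      ≤ HH R ^ 2 / q := by
  calc _ ≤ ∑ n ∈ Icc 1 R, (n : ℝ)⁻¹ * (HH R / q) := by
        refine sum_le_sum fun n hn => ?_
        have hn1 := (mem_Icc.1 hn).1
        rw [← sum_filter]
        calc _ ≤ ∑ m ∈ Icc 1 R with n < m ∧ (n : ZMod q) = m, (n : ℝ)⁻¹ * ((m - n : ℕ) : ℝ)⁻¹ := by
              refine sum_le_sum fun m hm => ?_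
              obtain ⟨hm, hnm, -⟩ := mem_filter.1 hm
              rw [mul_inv]
              have : 0 < m - n := by omega
              have : (0 : ℝ) < ((m - n : ℕ) : ℝ) := by exact_mod_cast this
              gcongr
              omega
          _ ≤ _ := by
              rw [← mul_sum]
              gcongr
              apply arith_sum_inj
              · intro a ha b hb hab
                simp only [coe_filter, Set.mem_ofPred_eq] at ha hb
                have := ha.2.1
                have := hb.2.1
                simp only at hab
                omega
              · intro m hm
                obtain ⟨hm, hnm, hz⟩ := mem_filter.1 hm
                have hmR := (mem_Icc.1 hm).2
                refine ⟨by omega, by omega, ?_⟩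
                exact (Nat.modEq_iff_dvd' hnm.le).1 ((ZMod.natCast_eq_natCast_iff _ _ _).1 hz)
    _ ≤ HH R * (HH R / q) := by
        rw [← sum_mul]
        have := HH_nonneg R
        gcongr
        exact sum_le_HH (by omega)
    _ = _ := by ring

lemma off_ne {q : ℕ} [NeZero q] (R : ℕ) :
    ∑ n ∈ Icc 1 R, ∑ m ∈ Icc 1 R, (if n ≠ m ∧ (n : ZMod q) = m then ((n : ℝ) * m)⁻¹ else 0)
      ≤ 2 * HH R ^ 2 / q := by
  have h1 := off_lt (q := q) R
  have h2 := h1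
  rw [sum_comm] at h2
  have h3 : ∑ n ∈ Icc 1 R, ∑ m ∈ Icc 1 R,
      (if n ≠ m ∧ (n : ZMod q) = m then ((n : ℝ) * m)⁻¹ else 0) ≤
      ∑ n ∈ Icc 1 R, ∑ m ∈ Icc 1 R,
        ((if n < m ∧ (n : ZMod q) = m then ((n : ℝ) * m)⁻¹ else 0) +
        (if m < n ∧ (m : ZMod q) = n then ((m : ℝ) * n)⁻¹ else 0)) := by
    refine sum_le_sum fun n _ => sum_le_sum fun m _ => ?_
    rcases lt_trichotomy n m with h | h | h
    · simp [h, h.ne, h.not_gt]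
    · simp [h]
    · simp [h, h.ne', h.not_gt, eq_comm, mul_comm]
  simp only [sum_add_distrib] at h3
  have : 2 * HH R ^ 2 / q = HH R ^ 2 / q + HH R ^ 2 / q := by ring
  linarith

lemma off_add_half {q : ℕ} [NeZero q] (R : ℕ) :
    ∑ n ∈ Icc 1 R, ∑ m ∈ Icc 1 R, (if (n : ZMod q) = -m then (n : ℝ)⁻¹ * ((n + m : ℕ) : ℝ)⁻¹ else 0)
      ≤ HH R ^ 2 / q := by
  calc _ ≤ ∑ n ∈ Icc 1 R, (n : ℝ)⁻¹ * (HH R / q) := by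
        refine sum_le_sum fun n hn => ?_
        have hn1 := (mem_Icc.1 hn)
        rw [← sum_filter, ← mul_sum]
        gcongr
        apply arith_sum_inj _ (fun m => n + m)
        · intro a ha b hb hab
          simpa using hab
        · intro m hm
          obtain ⟨hm, hz⟩ := mem_filter.1 hm
          have hmR := (mem_Icc.1 hm)
          refine ⟨by omega, by omega, ?_⟩
          rw [← ZMod.natCast_eq_zero_iff]
          push_cast
          rw [hz]; ring
    _ ≤ HH R * (HH R / q) := by
        rw [← sum_mul]
        have := HH_nonneg R
        gcongr
        exact sum_le_HH (by omega)
    _ = _ := by ring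

lemma off_add {q : ℕ} [NeZero q] (R : ℕ) :
    ∑ n ∈ Icc 1 R, ∑ m ∈ Icc 1 R, (if (n : ZMod q) = -m then ((n : ℝ) * m)⁻¹ else 0)
      ≤ 2 * HH R ^ 2 / q := by
  have h1 := off_add_half (q := q) R
  have h2 := h1
  rw [sum_comm] at h2
  have h3 : ∑ n ∈ Icc 1 R, ∑ m ∈ Icc 1 R,
      (if (n : ZMod q) = -m then ((n : ℝ) * m)⁻¹ else 0) =
      ∑ n ∈ Icc 1 R, ∑ m ∈ Icc 1 R,
        ((if (n : ZMod q) = -m then (n : ℝ)⁻¹ * ((n + m : ℕ) : ℝ)⁻¹ else 0) +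
        (if (m : ZMod q) = -n then (m : ℝ)⁻¹ * ((m + n : ℕ) : ℝ)⁻¹ else 0)) := by
    refine sum_congr rfl fun n hn => sum_congr rfl fun m hm => ?_
    have hn1 : (0 : ℝ) < n := by exact_mod_cast (mem_Icc.1 hn).1
    have hm1 : (0 : ℝ) < m := by exact_mod_cast (mem_Icc.1 hm).1
    have he : ((m : ZMod q) = -n) ↔ ((n : ZMod q) = -m) := by
      constructor <;> intro h <;> rw [h] <;> ring
    simp only [he]
    split_ifs
    · push_cast
      field_simp
      ring
    · simp
  rw [h3]
  simp only [sum_add_distrib]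
  have : 2 * HH R ^ 2 / q = HH R ^ 2 / q + HH R ^ 2 / q := by ring
  linarith

/-- The finite Dirichlet polynomial. -/
noncomputable def DP {q : ℕ} (R : ℕ) (f : ℕ → ℂ) (χ : DirichletCharacter ℂ q) : ℂ :=
  ∑ n ∈ Icc 1 R, f n * χ (n : ZMod q)

open scoped Classical in
lemma even_ms_eq {q : ℕ} [NeZero q] (R : ℕ) (f : ℕ → ℂ) :
    ((∑ χ : DirichletCharacter ℂ q, if χ.Even then ‖DP R f χ‖ ^ 2 else 0 : ℝ) : ℂ) =
    ∑ n ∈ Icc 1 R, ∑ m ∈ Icc 1 R, f n * (starRingEnd ℂ) (f m) *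
      (if IsUnit (m : ZMod q) then (q.totient : ℂ) / 2 *
        ((if (m : ZMod q) = n then 1 else 0) + (if (m : ZMod q) = -n then 1 else 0)) else 0) := by
  have h1 : ∀ χ : DirichletCharacter ℂ q,
      ((if χ.Even then ‖DP R f χ‖ ^ 2 else 0 : ℝ) : ℂ) =
      ∑ n ∈ Icc 1 R, ∑ m ∈ Icc 1 R, f n * (starRingEnd ℂ) (f m) *
        (if χ.Even then χ (n : ZMod q) * (starRingEnd ℂ) (χ (m : ZMod q)) else 0) := by
    intro χ
    split_ifs with he
    · push_cast
      rw [← Complex.mul_conj', DP, map_sum, sum_mul_sum]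
      refine sum_congr rfl fun n _ => sum_congr rfl fun m _ => ?_
      rw [map_mul]; ring
    · simp
  rw [Complex.ofReal_sum, sum_congr rfl fun χ _ => h1 χ, sum_comm]
  refine sum_congr rfl fun n _ => ?_
  rw [sum_comm]
  refine sum_congr rfl fun m _ => ?_
  rw [← mul_sum, even_orth]

open scoped Classical in
lemma even_ms {q : ℕ} [NeZero q] (R : ℕ) (f : ℕ → ℂ) {V : ℝ} (hV : 0 ≤ V)
    (hf : ∀ n ∈ Icc 1 R, ‖f n‖ ≤ V * (n : ℝ)⁻¹) :
    |(∑ χ : DirichletCharacter ℂ q, if χ.Even then ‖DP R f χ‖ ^ 2 else 0) -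
      (q.totient : ℝ) / 2 * ∑ n ∈ Icc 1 R, (if n.Coprime q then ‖f n‖ ^ 2 else 0)| ≤
      2 * V ^ 2 * HH R ^ 2 := by
  have hdiag : (((q.totient : ℝ) / 2 * ∑ n ∈ Icc 1 R, (if n.Coprime q then ‖f n‖ ^ 2 else 0) : ℝ) : ℂ)
      = ∑ n ∈ Icc 1 R, ∑ m ∈ Icc 1 R, (if n = m then f n * (starRingEnd ℂ) (f m) *
        (if IsUnit (m : ZMod q) then (q.totient : ℂ) / 2 else 0) else 0) := by
    push_cast
    rw [mul_sum]
    refine sum_congr rfl fun n hn => ?_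
    rw [sum_ite_eq, if_pos hn, Complex.mul_conj']
    simp only [ZMod.isUnit_iff_coprime]
    split_ifs <;> push_cast <;> ring
  rw [← Real.norm_eq_abs, ← Complex.norm_real, Complex.ofReal_sub, even_ms_eq, hdiag,
    ← sum_sub_distrib]
  simp_rw [← sum_sub_distrib]
  have hφ0 : (0 : ℝ) ≤ (q.totient : ℝ) / 2 := by positivity
  calc _ ≤ ∑ n ∈ Icc 1 R, ∑ m ∈ Icc 1 R, (q.totient : ℝ) / 2 * V ^ 2 *
        ((if n ≠ m ∧ (n : ZMod q) = m then ((n : ℝ) * m)⁻¹ else 0) +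
          (if (n : ZMod q) = -m then ((n : ℝ) * m)⁻¹ else 0)) := by
        refine norm_sum_le_of_le _ fun n hn => norm_sum_le_of_le _ fun m hm => ?_
        have hfn : ‖f n * (starRingEnd ℂ) (f m)‖ ≤ V ^ 2 * ((n : ℝ) * m)⁻¹ := by
          rw [norm_mul, RCLike.norm_conj]
          calc ‖f n‖ * ‖f m‖ ≤ (V * (n : ℝ)⁻¹) * (V * (m : ℝ)⁻¹) := by
                gcongr
                · exact hf n hn
                · exact hf m hm
            _ = _ := by rw [mul_inv]; ring
        have hx : (0 : ℝ) ≤ ((n : ℝ) * m)⁻¹ := by positivity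
        have he : ((m : ZMod q) = -n) ↔ ((n : ZMod q) = -m) := by
          constructor <;> intro h <;> rw [h] <;> ring
        have he2 : ((m : ZMod q) = n) ↔ ((n : ZMod q) = m) := eq_comm
        simp only [he, he2]
        by_cases hu : IsUnit (m : ZMod q)
        · simp only [hu, if_true]
          have key : ∀ (e : ℂ) (e' : ℝ), ‖e‖ ≤ e' → 0 ≤ e' →
              ‖f n * (starRingEnd ℂ) (f m) * ((q.totient : ℂ) / 2 * e)‖ ≤
              (q.totient : ℝ) / 2 * V ^ 2 * (((n : ℝ) * m)⁻¹ * e') := by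
            intro e e' he' he0
            have hn2 : ‖(q.totient : ℂ) / 2‖ = (q.totient : ℝ) / 2 := by simp
            rw [norm_mul, norm_mul ((q.totient : ℂ) / 2), hn2]
            calc _ ≤ (V ^ 2 * ((n : ℝ) * m)⁻¹) * ((q.totient : ℝ) / 2 * e') := by gcongr
              _ = _ := by ring
          by_cases hnm : n = m
          · subst hnm
            simp only [if_true, ne_eq, not_true_eq_false, false_and, if_false, zero_add]
            have := key (if (n : ZMod q) = -n then 1 else 0) (if (n : ZMod q) = -n then 1 else 0)
              (by split_ifs <;> simp) (by split_ifs <;> simp)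
            convert this using 1
            · congr 1
              split_ifs <;> ring
            · split_ifs <;> simp
          · simp only [hnm, if_false, sub_zero, ne_eq, not_false_eq_true, true_and]
            have := key ((if (n : ZMod q) = m then 1 else 0) + (if (n : ZMod q) = -m then 1 else 0))
              ((if (n : ZMod q) = m then 1 else 0) + (if (n : ZMod q) = -m then 1 else 0))
              (by split_ifs <;> norm_num) (by split_ifs <;> norm_num)
            convert this using 1
            split_ifs <;> ring
        · simp only [hu, if_false, mul_zero, ite_self, sub_zero, norm_zero]
          have : 0 ≤ (if n ≠ m ∧ (n : ZMod q) = m then ((n : ℝ) * m)⁻¹ else 0) +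
              (if (n : ZMod q) = -m then ((n : ℝ) * m)⁻¹ else 0) := by
            split_ifs <;> linarith
          positivity
    _ ≤ (q.totient : ℝ) / 2 * V ^ 2 * (2 * HH R ^ 2 / q + 2 * HH R ^ 2 / q) := by
        simp_rw [← mul_sum, sum_add_distrib]
        gcongr
        · exact off_ne R
        · exact off_add R
    _ ≤ (q : ℝ) / 2 * V ^ 2 * (2 * HH R ^ 2 / q + 2 * HH R ^ 2 / q) := by
        have : (q.totient : ℝ) ≤ q := by exact_mod_cast Nat.totient_le q
        gcongr
    _ = _ := by
        have : (q : ℝ) ≠ 0 := by exact_mod_cast NeZero.ne q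
        field_simp
        ring

end NSM

namespace NSM
open Finset

/-- Evaluation of a finitely supported arithmetic function at a character, with weight `1/n`. -/
noncomputable def ev {q : ℕ} (R : ℕ) (g : ArithmeticFunction ℂ) (χ : DirichletCharacter ℂ q) : ℂ :=
  DP R (fun n => g n / n) χ

lemma ev_add {q : ℕ} (R : ℕ) (g h : ArithmeticFunction ℂ) (χ : DirichletCharacter ℂ q) :
    ev R (g + h) χ = ev R g χ + ev R h χ := by
  simp only [ev, DP, ArithmeticFunction.add_apply, add_div, add_mul, sum_add_distrib]

lemma ev_one {q : ℕ} {R : ℕ} (hR : 1 ≤ R) (χ : DirichletCharacter ℂ q) :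
    ev R 1 χ = 1 := by
  simp only [ev, DP]
  rw [sum_eq_single_of_mem 1 (mem_Icc.2 ⟨le_rfl, hR⟩)]
  · simp
  · intro b _ hb
    simp [ArithmeticFunction.one_apply_ne hb]

lemma ev_mul {q : ℕ} {R A B : ℕ} {g h : ArithmeticFunction ℂ} (hg : ∀ n, A < n → g n = 0)
    (hh : ∀ n, B < n → h n = 0) (hAB : A * B ≤ R) (χ : DirichletCharacter ℂ q) :
    ev R (g * h) χ = ev R g χ * ev R h χ := by
  set F : ℕ × ℕ → ℂ := fun x => (g x.1 / x.1 * χ (x.1 : ZMod q)) * (h x.2 / x.2 * χ (x.2 : ZMod q))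
    with hF
  have h1 : ev R g χ * ev R h χ = ∑ x ∈ (Icc 1 R ×ˢ Icc 1 R), F x := by
    rw [ev, ev, DP, DP, sum_mul_sum, sum_product]
  have h2 : ∑ x ∈ (Icc 1 R ×ˢ Icc 1 R), F x =
      ∑ x ∈ (Icc 1 R ×ˢ Icc 1 R) with x.1 * x.2 ≤ R, F x := by
    refine (sum_filter_of_ne fun x _ hx => ?_).symm
    by_contra hcon
    apply hx
    have : A < x.1 ∨ B < x.2 := by
      by_contra h
      push Not at h
      exact hcon ((Nat.mul_le_mul h.1 h.2).trans hAB)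
    rcases this with h | h
    · simp [hF, hg _ h]
    · simp [hF, hh _ h]
  rw [h1, h2, ← sum_fiberwise_of_maps_to (t := Icc 1 R) (g := fun x => x.1 * x.2)]
  · rw [ev, DP]
    refine sum_congr rfl fun n hn => ?_
    have hn' := mem_Icc.1 hn
    rw [ArithmeticFunction.mul_apply, sum_div, sum_mul]
    refine sum_congr ?_ ?_
    · ext x
      simp only [Nat.mem_divisorsAntidiagonal, mem_filter, mem_product, mem_Icc]
      constructor
      · rintro ⟨rfl, h0⟩
        have ha : 0 < x.1 := Nat.pos_of_ne_zero (by rintro h; simp [h] at h0)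
        have hb : 0 < x.2 := Nat.pos_of_ne_zero (by rintro h; simp [h] at h0)
        have := Nat.le_mul_of_pos_right x.1 hb
        have := Nat.le_mul_of_pos_left x.2 ha
        refine ⟨⟨⟨⟨ha, by omega⟩, hb, by omega⟩, hn'.2⟩, rfl⟩
      · rintro ⟨-, h⟩
        exact ⟨h, by omega⟩
    · intro x hx
      simp only [mem_filter] at hx
      rw [hF, ← hx.2]
      push_cast
      rw [map_mul]
      ring
  · intro x hx
    simp only [mem_filter, mem_product, mem_Icc] at hx
    rw [mem_Icc]
    exact ⟨Nat.mul_pos hx.1.1.1 hx.1.2.1, hx.2⟩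

/-- Truncation of an arithmetic function. -/
noncomputable def trunc (N : ℕ) (g : ArithmeticFunction ℂ) : ArithmeticFunction ℂ :=
  ⟨fun n => if n ≤ N then g n else 0, by simp⟩

lemma trunc_apply (N : ℕ) (g : ArithmeticFunction ℂ) (n : ℕ) :
    trunc N g n = if n ≤ N then g n else 0 := rfl

noncomputable def muC : ArithmeticFunction ℂ := ((ArithmeticFunction.moebius : ArithmeticFunction ℤ) : ArithmeticFunction ℂ)
noncomputable def zeC : ArithmeticFunction ℂ := ((ArithmeticFunction.zeta : ArithmeticFunction ℕ) : ArithmeticFunction ℂ)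

lemma muC_apply (n : ℕ) : muC n = (ArithmeticFunction.moebius n : ℂ) := rfl

lemma zeC_apply {n : ℕ} (hn : n ≠ 0) : zeC n = 1 := by
  simp [zeC, hn]

lemma mu_ze : muC * zeC = 1 := by
  rw [muC, zeC]; exact ArithmeticFunction.coe_moebius_mul_coe_zeta

lemma norm_muC (n : ℕ) : ‖muC n‖ ≤ 1 := by
  rw [muC_apply, Complex.norm_intCast]
  exact_mod_cast ArithmeticFunction.abs_moebius_le_one

lemma norm_zeC (n : ℕ) : ‖zeC n‖ ≤ 1 := by
  by_cases hn : n = 0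
  · simp [hn]
  · simp [zeC_apply hn]

lemma norm_trunc {N : ℕ} {g : ArithmeticFunction ℂ} (hg : ∀ n, ‖g n‖ ≤ 1) (n : ℕ) :
    ‖trunc N g n‖ ≤ 1 := by
  rw [trunc_apply]
  split_ifs
  · exact hg n
  · simp

lemma mul_congr_le {N n : ℕ} (hn : n ≤ N) {g h g' h' : ArithmeticFunction ℂ}
    (hg : ∀ k ≤ N, g k = g' k) (hh : ∀ k ≤ N, h k = h' k) : (g * h) n = (g' * h') n := by
  rw [ArithmeticFunction.mul_apply, ArithmeticFunction.mul_apply]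
  refine sum_congr rfl fun x hx => ?_
  obtain ⟨h1, h2⟩ := Nat.mem_divisorsAntidiagonal.1 hx
  have ha : x.1 ≤ n := Nat.le_of_dvd (Nat.pos_of_ne_zero h2) (Dvd.intro _ h1)
  have hb : x.2 ≤ n := Nat.le_of_dvd (Nat.pos_of_ne_zero h2) (Dvd.intro_left _ h1)
  rw [hg _ (ha.trans hn), hh _ (hb.trans hn)]

lemma mul_supp {A B : ℕ} {g h : ArithmeticFunction ℂ} (hg : ∀ n, A < n → g n = 0)
    (hh : ∀ n, B < n → h n = 0) (n : ℕ) (hn : A * B < n) : (g * h) n = 0 := by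
  rw [ArithmeticFunction.mul_apply]
  refine sum_eq_zero fun x hx => ?_
  obtain ⟨h1, h2⟩ := Nat.mem_divisorsAntidiagonal.1 hx
  have : A < x.1 ∨ B < x.2 := by
    by_contra h
    push Not at h
    have := Nat.mul_le_mul h.1 h.2
    omega
  rcases this with h | h
  · simp [hg _ h]
  · simp [hh _ h]

lemma norm_mul_le_card {g h : ArithmeticFunction ℂ} {n : ℕ} {V : ℝ} (hg : ∀ k, ‖g k‖ ≤ 1)
    (hh : ∀ k, k ≠ 0 → k ≤ n → ‖h k‖ ≤ V) : ‖(g * h) n‖ ≤ n.divisors.card * V := by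
  rw [ArithmeticFunction.mul_apply]
  have hc : n.divisors.card = n.divisorsAntidiagonal.card := by
    rw [← Nat.map_div_right_divisors, card_map]
  rw [hc, ← nsmul_eq_mul]
  refine norm_sum_le_of_le _ (f := fun x : ℕ × ℕ => g x.1 * h x.2) (n := fun _ => V) (fun x hx => ?_) |>.trans (by rw [sum_const])
  obtain ⟨h1, h2⟩ := Nat.mem_divisorsAntidiagonal.1 hx
  have hb : x.2 ≤ n := Nat.le_of_dvd (Nat.pos_of_ne_zero h2) (Dvd.intro_left _ h1)
  have hb0 : x.2 ≠ 0 := by rintro h; simp [h] at h1; omega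
  rw [norm_mul]
  have := hh _ hb0 hb
  have hV : 0 ≤ V := (norm_nonneg _).trans this
  calc ‖g x.1‖ * ‖h x.2‖ ≤ 1 * V := by
        gcongr
        exact hg _
    _ = V := one_mul V

noncomputable def aA (N : ℕ) : ArithmeticFunction ℂ := 1 + -(trunc N muC * trunc N zeC)
noncomputable def bA (N : ℕ) : ArithmeticFunction ℂ := trunc N muC + trunc N muC * aA N

lemma trunc_supp (N : ℕ) (g : ArithmeticFunction ℂ) (n : ℕ) (hn : N < n) : trunc N g n = 0 := by
  rw [trunc_apply, if_neg (by omega)]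

lemma aA_small {N n : ℕ} (hn : n ≤ N) : aA N n = 0 := by
  have : (trunc N muC * trunc N zeC) n = (muC * zeC) n :=
    mul_congr_le hn (fun k hk => by rw [trunc_apply, if_pos hk])
      (fun k hk => by rw [trunc_apply, if_pos hk])
  rw [aA, ArithmeticFunction.add_apply, ArithmeticFunction.neg_apply, this, mu_ze]
  ring

lemma aA_supp {N : ℕ} (hN : 1 ≤ N) (n : ℕ) (hn : N * N < n) : aA N n = 0 := by
  rw [aA, ArithmeticFunction.add_apply, ArithmeticFunction.neg_apply,
    mul_supp (trunc_supp N _) (trunc_supp N _) n hn, ArithmeticFunction.one_apply_ne]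
  · simp
  · have : 1 * 1 ≤ N * N := Nat.mul_le_mul hN hN
    omega

lemma norm_aA {N n : ℕ} (hN : 1 ≤ N) : ‖aA N n‖ ≤ n.divisors.card := by
  by_cases hn : n ≤ N
  · rw [aA_small hn]; simp
  · rw [aA, ArithmeticFunction.add_apply, ArithmeticFunction.neg_apply,
      ArithmeticFunction.one_apply_ne (by omega), zero_add, norm_neg]
    have := norm_mul_le_card (g := trunc N muC) (h := trunc N zeC) (n := n) (V := 1)
      (norm_trunc norm_muC) (fun k _ _ => norm_trunc norm_zeC k)
    simpa using this

lemma bA_small {N n : ℕ} (hn : n ≤ N) : bA N n = muC n := by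
  have : (trunc N muC * aA N) n = (trunc N muC * 0) n :=
    mul_congr_le hn (fun k hk => rfl) (fun k hk => by rw [aA_small hk]; rfl)
  rw [bA, ArithmeticFunction.add_apply, this, mul_zero, trunc_apply, if_pos hn]
  simp

lemma norm_bA {N R n : ℕ} (hN : 1 ≤ N) {V : ℝ} (hV : 1 ≤ V)
    (hd : ∀ k, k ≠ 0 → k ≤ R → (k.divisors.card : ℝ) ≤ V) (hn0 : n ≠ 0) (hn : n ≤ R) :
    ‖bA N n‖ ≤ V ^ 2 := by
  by_cases hnN : n ≤ N
  · rw [bA_small hnN]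
    exact (norm_muC n).trans (one_le_pow₀ hV)
  · rw [bA, ArithmeticFunction.add_apply, trunc_supp _ _ _ (by omega), zero_add]
    refine (norm_mul_le_card (V := V) (norm_trunc norm_muC) (fun k hk0 hk => (norm_aA hN).trans
      (hd k hk0 (hk.trans hn)))).trans ?_
    rw [sq]
    gcongr
    exact hd n hn0 hn

end NSM

namespace NSM
open Finset

lemma ev_neg {q : ℕ} (R : ℕ) (g : ArithmeticFunction ℂ) (χ : DirichletCharacter ℂ q) :
    ev R (-g) χ = -ev R g χ := by
  simp only [ev, DP, ArithmeticFunction.neg_apply, neg_div, neg_mul, sum_neg_distrib]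

lemma norm_ev_le {q : ℕ} {R : ℕ} {g : ArithmeticFunction ℂ} (hg : ∀ n, ‖g n‖ ≤ 1)
    (χ : DirichletCharacter ℂ q) : ‖ev R g χ‖ ≤ HH R := by
  refine le_trans ?_ (sum_le_HH (R := R) (X := R) (by omega))
  rw [ev, DP]
  refine norm_sum_le_of_le _ fun n _ => ?_
  rw [norm_mul, norm_div, Complex.norm_natCast]
  have h1 := χ.norm_le_one (n : ZMod q)
  calc _ ≤ 1 / (n : ℝ) * 1 := by
        gcongr
        exact hg n
    _ = _ := by ring

lemma ev_zeC {q : ℕ} {N R : ℕ} (hNR : N ≤ R) (χ : DirichletCharacter ℂ q) :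
    ev R (trunc N zeC) χ = ∑ n ∈ range N, χ ((n + 1 : ℕ) : ZMod q) / ((n + 1 : ℕ) : ℂ) := by
  have h1 : ev R (trunc N zeC) χ = ∑ n ∈ Icc 1 N, χ (n : ZMod q) / (n : ℂ) := by
    rw [ev, DP]
    symm
    refine sum_subset_zero_on_sdiff (Icc_subset_Icc_right hNR) ?_ ?_
    · intro n hn
      have h2 := mem_sdiff.1 hn
      rw [mem_Icc, mem_Icc] at h2
      rw [trunc_supp _ _ _ (by omega)]; simp
    · intro n hn
      rw [mem_Icc] at hn
      rw [trunc_apply, if_pos hn.2, zeC_apply (by omega)]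
      ring
  rw [h1, range_eq_Ico, Finset.sum_Ico_add' (fun k : ℕ => χ ((k : ℕ) : ZMod q) / ((k : ℕ) : ℂ)) 0 N 1]
  rfl

/-- The four Dirichlet polynomials and their relations. -/
lemma polys {q : ℕ} [NeZero q] (hq : 3 ≤ q) (χ : DirichletCharacter ℂ q) :
    ∃ M P : ℂ, ‖M‖ ≤ HH (q ^ 6) ∧ ‖P‖ ≤ HH (q ^ 6) ∧ (χ ≠ 1 → ‖χ.LFunction 1 - P‖ ≤ 2 / q) ∧
      ev (q ^ 6) (aA (q * q)) χ = 1 - M * P ∧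
      ev (q ^ 6) (bA (q * q)) χ = M * (1 + ev (q ^ 6) (aA (q * q)) χ) := by
  have hN : 1 ≤ q * q := by nlinarith
  have h6 : q * q * (q * q * (q * q)) = q ^ 6 := by ring
  have h2 : q * q * (q * q) ≤ q ^ 6 := by
    rw [← h6]; exact Nat.mul_le_mul_left _ (Nat.le_mul_of_pos_left _ (by omega))
  have h3 : q * q ≤ q ^ 6 := le_trans (Nat.le_mul_of_pos_left _ (by omega)) h2
  refine ⟨ev (q ^ 6) (trunc (q * q) muC) χ, ev (q ^ 6) (trunc (q * q) zeC) χ,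
    norm_ev_le (norm_trunc norm_muC) χ, norm_ev_le (norm_trunc norm_zeC) χ, ?_, ?_, ?_⟩
  · intro hχ
    rw [ev_zeC h3]
    exact L_one_approx χ hχ (by omega)
  · nth_rw 1 [aA]
    rw [ev_add, ev_neg, ev_one (by omega), ev_mul (trunc_supp _ _) (trunc_supp _ _) h2]
    ring
  · nth_rw 1 [bA]
    rw [ev_add, ev_mul (trunc_supp _ _) (aA_supp hN) h6.le]
    ring

lemma tail_inv_sq {N R : ℕ} (hN : 1 ≤ N) (hNR : N ≤ R) :
    ∑ n ∈ Ioc N R, ((n : ℝ) ^ 2)⁻¹ ≤ (N : ℝ)⁻¹ := by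
  have := sum_Ioc_inv_sq_le_sub (α := ℝ) (k := N) (n := R) (by omega) hNR
  have h : (0 : ℝ) ≤ (R : ℝ)⁻¹ := by positivity
  linarith

open scoped Classical in
lemma sum_E {q : ℕ} [NeZero q] (hq : 3 ≤ q) :
    (∑ χ : DirichletCharacter ℂ q, if χ.Even then ‖ev (q ^ 6) (aA (q * q)) χ‖ ^ 2 else 0) ≤
      3 * Real.exp (26 * TT q) ^ 2 * HH (q ^ 6) ^ 2 := by
  set V := Real.exp (26 * TT q) with hV
  have hV0 : 0 < V := Real.exp_pos _
  have hH1 : 1 ≤ HH (q ^ 6) := one_le_HH (Nat.one_le_pow _ _ (by omega))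
  have hN : 1 ≤ q * q := by nlinarith
  have h3 : q * q ≤ q ^ 6 := by
    rw [← pow_two]; exact Nat.pow_le_pow_right (by omega) (by omega)
  have hb : ∀ n ∈ Icc 1 (q ^ 6), ‖aA (q * q) n / (n : ℂ)‖ ≤ V * (n : ℝ)⁻¹ := by
    intro n hn
    rw [mem_Icc] at hn
    rw [norm_div, Complex.norm_natCast, div_eq_mul_inv]
    gcongr
    exact (norm_aA hN).trans (divisor_bound hq (by omega) hn.2)
  have h := even_ms (q := q) (q ^ 6) (fun n => aA (q * q) n / (n : ℂ)) hV0.le hb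
  have h1 := (abs_le.1 h).2
  have hsum : ∑ n ∈ Icc 1 (q ^ 6), (if n.Coprime q then ‖aA (q * q) n / (n : ℂ)‖ ^ 2 else 0) ≤
      V ^ 2 * ((q * q : ℕ) : ℝ)⁻¹ := by
    calc _ ≤ ∑ n ∈ Icc 1 (q ^ 6), (if q * q < n then V ^ 2 * ((n : ℝ) ^ 2)⁻¹ else 0) := by
          refine sum_le_sum fun n hn => ?_
          by_cases hn2 : q * q < n
          · rw [if_pos hn2]
            have := hb n hn
            have h5 : ‖aA (q * q) n / (n : ℂ)‖ ^ 2 ≤ V ^ 2 * ((n : ℝ) ^ 2)⁻¹ := by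
              calc _ ≤ (V * (n : ℝ)⁻¹) ^ 2 := by gcongr
                _ = _ := by rw [mul_pow, inv_pow]
            split_ifs
            · exact h5
            · positivity
          · rw [if_neg hn2, aA_small (by omega)]
            simp
      _ = V ^ 2 * ∑ n ∈ Ioc (q * q) (q ^ 6), ((n : ℝ) ^ 2)⁻¹ := by
          rw [← sum_filter, mul_sum]
          refine sum_congr ?_ fun _ _ => rfl
          ext n; simp only [mem_filter, mem_Icc, mem_Ioc]; omega
      _ ≤ _ := by
          gcongr
          exact tail_inv_sq hN h3
  have hφ : (q.totient : ℝ) / 2 * (V ^ 2 * ((q * q : ℕ) : ℝ)⁻¹) ≤ V ^ 2 := by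
    have h4 : (q.totient : ℝ) ≤ q := by exact_mod_cast Nat.totient_le q
    have hq0 : (1 : ℝ) ≤ q := by exact_mod_cast (by omega : 1 ≤ q)
    have h5 : (q.totient : ℝ) / 2 * ((q * q : ℕ) : ℝ)⁻¹ ≤ 1 := by
      push_cast
      rw [← div_eq_mul_inv, div_le_one (by positivity)]
      nlinarith
    nlinarith [sq_nonneg V]
  have h6 : (q.totient : ℝ) / 2 * ∑ n ∈ Icc 1 (q ^ 6), (if n.Coprime q then ‖aA (q * q) n / (n : ℂ)‖ ^ 2 else 0) ≤ V ^ 2 :=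
    le_trans (by gcongr) hφ
  have h7 : V ^ 2 ≤ V ^ 2 * HH (q ^ 6) ^ 2 := le_mul_of_one_le_right (by positivity) (one_le_pow₀ hH1)
  have h8 : (∑ χ : DirichletCharacter ℂ q, if χ.Even then ‖ev (q ^ 6) (aA (q * q)) χ‖ ^ 2 else 0) ≤
     2 * V ^ 2 * HH (q ^ 6) ^ 2 + V ^ 2 := by
    simp only [ev]; linarith
  linarith

/-- The main-term series. -/
noncomputable def AQ (q : ℕ) : ℝ :=
  ∑' n : ℕ, if n.Coprime q then ((ArithmeticFunction.moebius n : ℤ) : ℝ) ^ 2 * ((n : ℝ) ^ 2)⁻¹ else 0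

lemma mob_sq_le (n : ℕ) : ((ArithmeticFunction.moebius n : ℤ) : ℝ) ^ 2 ≤ 1 := by
  rw [sq_le_one_iff_abs_le_one]
  exact_mod_cast ArithmeticFunction.abs_moebius_le_one

lemma aq_term_le (q n : ℕ) : (if n.Coprime q then ((ArithmeticFunction.moebius n : ℤ) : ℝ) ^ 2 * ((n : ℝ) ^ 2)⁻¹ else 0)
    ≤ ((n : ℝ) ^ 2)⁻¹ := by
  split_ifs
  · exact mul_le_of_le_one_left (by positivity) (mob_sq_le n)
  · positivity

lemma aq_term_nonneg (q n : ℕ) : 0 ≤ (if n.Coprime q then ((ArithmeticFunction.moebius n : ℤ) : ℝ) ^ 2 * ((n : ℝ) ^ 2)⁻¹ else 0) := by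
  split_ifs <;> positivity

lemma aq_summable (q : ℕ) : Summable fun n : ℕ =>
    if n.Coprime q then ((ArithmeticFunction.moebius n : ℤ) : ℝ) ^ 2 * ((n : ℝ) ^ 2)⁻¹ else 0 :=
  Summable.of_nonneg_of_le (aq_term_nonneg q) (aq_term_le q)
    (Real.summable_nat_pow_inv.2 (by norm_num))

lemma AQ_approx {q N : ℕ} (hN : 1 ≤ N) :
    |AQ q - ∑ n ∈ Icc 1 N, (if n.Coprime q then ((ArithmeticFunction.moebius n : ℤ) : ℝ) ^ 2 * ((n : ℝ) ^ 2)⁻¹ else 0)|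
      ≤ (N : ℝ)⁻¹ := by
  set a : ℕ → ℝ := fun n => if n.Coprime q then ((ArithmeticFunction.moebius n : ℤ) : ℝ) ^ 2 * ((n : ℝ) ^ 2)⁻¹ else 0 with ha
  have hpart : ∀ s : Finset ℕ, Icc 1 N ⊆ s → ∑ n ∈ s, a n ≤ ∑ n ∈ Icc 1 N, a n + (N : ℝ)⁻¹ := by
    intro s hs
    obtain ⟨R, hR⟩ : ∃ R, ∀ n ∈ s, n ≤ R := ⟨s.sup id, fun n hn => le_sup (f := id) hn⟩
    have h1 : ∑ n ∈ s, a n ≤ ∑ n ∈ Icc 0 (R + N), a n :=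
      sum_le_sum_of_subset_of_nonneg (fun n hn => by rw [mem_Icc]; have := hR n hn; omega)
        (fun n _ _ => aq_term_nonneg q n)
    have h2 : ∑ n ∈ Icc 0 (R + N), a n = a 0 + (∑ n ∈ Icc 1 N, a n + ∑ n ∈ Ioc N (R + N), a n) := by
      rw [← sum_union, ← sum_insert (s := Icc 1 N ∪ Ioc N (R + N))]
      · refine sum_congr ?_ fun _ _ => rfl
        ext n; simp only [mem_insert, mem_union, mem_Icc, mem_Ioc]; omega
      · simp
      · rw [disjoint_left]; intro n; rw [mem_Icc, mem_Ioc]; omega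
    have h3 : a 0 = 0 := by simp [ha]
    have h4 : ∑ n ∈ Ioc N (R + N), a n ≤ (N : ℝ)⁻¹ :=
      (sum_le_sum fun n _ => aq_term_le q n).trans (tail_inv_sq hN (by omega))
    linarith
  have hle : ∑ n ∈ Icc 1 N, a n ≤ AQ q := (aq_summable q).sum_le_tsum _ (fun n _ => aq_term_nonneg q n)
  have hge : AQ q ≤ ∑ n ∈ Icc 1 N, a n + (N : ℝ)⁻¹ := by
    refine (aq_summable q).tsum_le_of_sum_le fun s => ?_
    refine le_trans ?_ (hpart (s ∪ Icc 1 N) subset_union_right)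
    exact sum_le_sum_of_subset_of_nonneg subset_union_left (fun n _ _ => aq_term_nonneg q n)
  rw [abs_le]
  constructor
  · have : (0 : ℝ) ≤ (N : ℝ)⁻¹ := by positivity
    linarith
  · linarith

open scoped Classical in
lemma sum_B {q : ℕ} [NeZero q] (hq : 3 ≤ q) :
    |(∑ χ : DirichletCharacter ℂ q, if χ.Even then ‖ev (q ^ 6) (bA (q * q)) χ‖ ^ 2 else 0) -
      (q.totient : ℝ) / 2 * AQ q| ≤
      3 * Real.exp (26 * TT q) ^ 4 * HH (q ^ 6) ^ 2 := by
  set V := Real.exp (26 * TT q) with hV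
  have hV0 : 0 < V := Real.exp_pos _
  have hV1 : 1 ≤ V := Real.one_le_exp (by linarith [one_le_TT hq])
  have hH1 : 1 ≤ HH (q ^ 6) := one_le_HH (Nat.one_le_pow _ _ (by omega))
  have hN : 1 ≤ q * q := by nlinarith
  have h3 : q * q ≤ q ^ 6 := by
    rw [← pow_two]; exact Nat.pow_le_pow_right (by omega) (by omega)
  have hb : ∀ n ∈ Icc 1 (q ^ 6), ‖bA (q * q) n / (n : ℂ)‖ ≤ V ^ 2 * (n : ℝ)⁻¹ := by
    intro n hn
    rw [mem_Icc] at hn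
    rw [norm_div, Complex.norm_natCast, div_eq_mul_inv]
    gcongr
    exact norm_bA hN hV1 (fun k hk hk2 => divisor_bound hq hk hk2) (by omega) hn.2
  have h := even_ms (q := q) (q ^ 6) (fun n => bA (q * q) n / (n : ℂ)) (by positivity) hb
  set F := ∑ n ∈ Icc 1 (q ^ 6), (if n.Coprime q then ‖bA (q * q) n / (n : ℂ)‖ ^ 2 else 0) with hF
  have hsplit : F = ∑ n ∈ Icc 1 (q * q), (if n.Coprime q then ((ArithmeticFunction.moebius n : ℤ) : ℝ) ^ 2 * ((n : ℝ) ^ 2)⁻¹ else 0)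
      + ∑ n ∈ Ioc (q * q) (q ^ 6), (if n.Coprime q then ‖bA (q * q) n / (n : ℂ)‖ ^ 2 else 0) := by
    have e : Icc 1 (q ^ 6) = Icc 1 (q * q) ∪ Ioc (q * q) (q ^ 6) := by
      ext n; simp only [mem_union, mem_Icc, mem_Ioc]; omega
    rw [hF, e, sum_union]
    · congr 1
      refine sum_congr rfl fun n hn => ?_
      rw [mem_Icc] at hn
      rw [bA_small hn.2, muC_apply, norm_div, Complex.norm_natCast, Complex.norm_intCast, div_pow, sq_abs,
        div_eq_mul_inv]
    · rw [disjoint_left]; intro n; rw [mem_Icc, mem_Ioc]; omega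
  have ht0 : 0 ≤ ∑ n ∈ Ioc (q * q) (q ^ 6), (if n.Coprime q then ‖bA (q * q) n / (n : ℂ)‖ ^ 2 else 0) :=
    sum_nonneg fun n _ => by split_ifs <;> positivity
  have ht : ∑ n ∈ Ioc (q * q) (q ^ 6), (if n.Coprime q then ‖bA (q * q) n / (n : ℂ)‖ ^ 2 else 0) ≤
      V ^ 4 * ((q * q : ℕ) : ℝ)⁻¹ := by
    calc _ ≤ ∑ n ∈ Ioc (q * q) (q ^ 6), V ^ 4 * ((n : ℝ) ^ 2)⁻¹ := by
          refine sum_le_sum fun n hn => ?_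
          have hn' := mem_Ioc.1 hn
          have := hb n (mem_Icc.2 ⟨by omega, hn'.2⟩)
          have h5 : ‖bA (q * q) n / (n : ℂ)‖ ^ 2 ≤ V ^ 4 * ((n : ℝ) ^ 2)⁻¹ := by
            calc _ ≤ (V ^ 2 * (n : ℝ)⁻¹) ^ 2 := by gcongr
              _ = _ := by rw [mul_pow, inv_pow]; ring
          split_ifs
          · exact h5
          · positivity
      _ = V ^ 4 * ∑ n ∈ Ioc (q * q) (q ^ 6), ((n : ℝ) ^ 2)⁻¹ := by rw [mul_sum]
      _ ≤ _ := by
          gcongr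
          exact tail_inv_sq hN h3
  have hA := abs_le.1 (AQ_approx (q := q) hN)
  have hV4 : 1 ≤ V ^ 4 := one_le_pow₀ hV1
  have hNi : (0 : ℝ) ≤ ((q * q : ℕ) : ℝ)⁻¹ := by positivity
  have hFA : |F - AQ q| ≤ 2 * (V ^ 4 * ((q * q : ℕ) : ℝ)⁻¹) := by
    have : 1 * ((q * q : ℕ) : ℝ)⁻¹ ≤ V ^ 4 * ((q * q : ℕ) : ℝ)⁻¹ := by gcongr
    rw [abs_le]
    constructor <;> linarith [hA.1, hA.2]
  have hφ : (q.totient : ℝ) / 2 * (2 * (V ^ 4 * ((q * q : ℕ) : ℝ)⁻¹)) ≤ V ^ 4 := by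
    have h4 : (q.totient : ℝ) ≤ q := by exact_mod_cast Nat.totient_le q
    have hq0 : (1 : ℝ) ≤ q := by exact_mod_cast (by omega : 1 ≤ q)
    have h5 : (q.totient : ℝ) * ((q * q : ℕ) : ℝ)⁻¹ ≤ 1 := by
      push_cast
      rw [← div_eq_mul_inv, div_le_one (by positivity)]
      nlinarith
    nlinarith
  have h7 : V ^ 4 ≤ V ^ 4 * HH (q ^ 6) ^ 2 := le_mul_of_one_le_right (by positivity) (one_le_pow₀ hH1)
  have h9 : |(q.totient : ℝ) / 2 * F - (q.totient : ℝ) / 2 * AQ q| ≤ V ^ 4 := by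
    rw [← mul_sub, abs_mul, abs_of_nonneg (by positivity)]
    exact le_trans (by gcongr) hφ
  have h10 := abs_sub_le (∑ χ : DirichletCharacter ℂ q, if χ.Even then ‖ev (q ^ 6) (bA (q * q)) χ‖ ^ 2 else 0)
    ((q.totient : ℝ) / 2 * F) ((q.totient : ℝ) / 2 * AQ q)
  have h11 : 2 * (V ^ 2) ^ 2 * HH (q ^ 6) ^ 2 = 2 * (V ^ 4 * HH (q ^ 6) ^ 2) := by ring
  rw [h11] at h
  simp only [ev] at h10 ⊢
  linarith

end NSM

namespace NSM
open Finset

lemma norm_B {q : ℕ} [NeZero q] (hq : 3 ≤ q) (χ : DirichletCharacter ℂ q) :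
    ‖ev (q ^ 6) (bA (q * q)) χ‖ ≤ 3 * HH (q ^ 6) ^ 3 := by
  obtain ⟨M, P, hM, hP, -, hE, hB⟩ := polys hq χ
  have hH1 : 1 ≤ HH (q ^ 6) := one_le_HH (Nat.one_le_pow _ _ (by omega))
  set H := HH (q ^ 6)
  rw [hB, hE, norm_mul]
  have h1 : ‖1 + (1 - M * P)‖ ≤ 3 * H ^ 2 := by
    calc ‖1 + (1 - M * P)‖ ≤ ‖(1 : ℂ)‖ + (‖(1 : ℂ)‖ + ‖M * P‖) :=
          (norm_add_le _ _).trans (by gcongr; exact norm_sub_le _ _)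
      _ ≤ 1 + (1 + H * H) := by
          rw [norm_mul, norm_one]
          gcongr
      _ ≤ _ := by nlinarith
  calc ‖M‖ * ‖1 + (1 - M * P)‖ ≤ H * (3 * H ^ 2) := by gcongr
    _ = _ := by ring

lemma good_char {q : ℕ} [NeZero q] (hq : 3 ≤ q) {W : ℝ} (hW : 1 ≤ W) (χ : DirichletCharacter ℂ q)
    (hχ : χ ≠ 1) (hL0 : χ.LFunction 1 ≠ 0) (hL : 1 / ‖χ.LFunction 1‖ ≤ W) :
    |1 / ‖χ.LFunction 1‖ ^ 2 - ‖ev (q ^ 6) (bA (q * q)) χ‖ ^ 2| ≤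
      4 * W ^ 2 * HH (q ^ 6) ^ 3 * (‖ev (q ^ 6) (aA (q * q)) χ‖ ^ 2 + 6 * HH (q ^ 6) ^ 3 / q) := by
  have hBn := norm_B hq χ
  obtain ⟨M, P, hM, hP, hLP, hE, hB⟩ := polys hq χ
  replace hLP := hLP hχ
  have hH1 : 1 ≤ HH (q ^ 6) := one_le_HH (Nat.one_le_pow _ _ (by omega))
  set H := HH (q ^ 6)
  set E := ev (q ^ 6) (aA (q * q)) χ
  set B := ev (q ^ 6) (bA (q * q)) χ
  set L := χ.LFunction 1
  have hD : 1 / L - B = (E ^ 2 - (L - P) * B) * (1 / L) := by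
    have : P * B = 1 - E ^ 2 := by
      rw [hB]
      have : M * P = 1 - E := by rw [hE]; ring
      linear_combination (1 + E) * this
    field_simp
    linear_combination (-1 : ℂ) * this
  have hDn : ‖1 / L - B‖ ≤ (‖E‖ ^ 2 + 6 * H ^ 3 / q) * W := by
    rw [hD, norm_mul]
    have h1 : ‖1 / L‖ ≤ W := by rw [norm_div, norm_one]; exact hL
    have h2 : ‖E ^ 2 - (L - P) * B‖ ≤ ‖E‖ ^ 2 + 6 * H ^ 3 / q := by
      calc _ ≤ ‖E ^ 2‖ + ‖(L - P) * B‖ := norm_sub_le _ _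
        _ ≤ ‖E‖ ^ 2 + 2 / q * (3 * H ^ 3) := by
            rw [norm_mul, norm_pow]; gcongr
        _ = _ := by ring
    gcongr
  have h3 : 1 / ‖L‖ ^ 2 - ‖B‖ ^ 2 = (‖1 / L‖ - ‖B‖) * (‖1 / L‖ + ‖B‖) := by
    rw [norm_div, norm_one]; ring
  have hHp : 1 ≤ H ^ 3 := one_le_pow₀ hH1
  have h4 : ‖1 / L‖ + ‖B‖ ≤ 4 * W * H ^ 3 := by
    rw [norm_div, norm_one]
    nlinarith
  rw [h3, abs_mul, abs_of_nonneg (a := ‖1 / L‖ + ‖B‖) (by positivity)]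
  calc _ ≤ ((‖E‖ ^ 2 + 6 * H ^ 3 / q) * W) * (4 * W * H ^ 3) := by
        gcongr
        exact (abs_norm_sub_norm_le _ _).trans hDn
    _ = _ := by ring

open scoped Classical in
lemma main_bound {q : ℕ} [NeZero q] (hq : 3 ≤ q) {W U : ℝ} (hW : 1 ≤ W) (hU : 0 ≤ U)
    (x : DirichletCharacter ℂ q)
    (hgood : ∀ χ : DirichletCharacter ℂ q, χ ≠ 1 → χ ≠ x →
      χ.LFunction 1 ≠ 0 ∧ 1 / ‖χ.LFunction 1‖ ≤ W)
    (hx : x ≠ 1 → 1 / ‖x.LFunction 1‖ ^ 2 ≤ U) :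
    |(∑ χ : DirichletCharacter ℂ q, if χ ≠ 1 ∧ χ.Even then 1 / ‖χ.LFunction 1‖ ^ 2 else 0) -
      (q.totient : ℝ) / 2 * AQ q| ≤
      57 * W ^ 2 * Real.exp (26 * TT q) ^ 4 * HH (q ^ 6) ^ 6 + U := by
  have hE := sum_E hq
  have hB := sum_B hq
  have hBn := fun χ : DirichletCharacter ℂ q => norm_B hq χ
  have hg := fun χ : DirichletCharacter ℂ q => good_char hq hW χ
  have hH1 : 1 ≤ HH (q ^ 6) := one_le_HH (Nat.one_le_pow _ _ (by omega))
  have hV1 : 1 ≤ Real.exp (26 * TT q) := Real.one_le_exp (by linarith [one_le_TT hq])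
  set V := Real.exp (26 * TT q)
  set H := HH (q ^ 6)
  have hq0 : (0 : ℝ) < q := by exact_mod_cast (by omega : 0 < q)
  have hterm : ∀ χ : DirichletCharacter ℂ q,
      |(if χ ≠ 1 ∧ χ.Even then 1 / ‖χ.LFunction 1‖ ^ 2 else 0) -
        (if χ.Even then ‖ev (q ^ 6) (bA (q * q)) χ‖ ^ 2 else 0)| ≤
      4 * W ^ 2 * H ^ 3 * ((if χ.Even then ‖ev (q ^ 6) (aA (q * q)) χ‖ ^ 2 else 0) + 6 * H ^ 3 / q)
        + (if χ = 1 then 9 * H ^ 6 else 0) + (if χ = x then 9 * H ^ 6 + U else 0) := by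
    intro χ
    have hB2 : ‖ev (q ^ 6) (bA (q * q)) χ‖ ^ 2 ≤ 9 * H ^ 6 := by
      calc _ ≤ (3 * H ^ 3) ^ 2 := by gcongr; exact hBn χ
        _ = _ := by ring
    have hr1 : (0 : ℝ) ≤ (if χ = 1 then 9 * H ^ 6 else 0) := by split_ifs <;> positivity
    have hr2 : (0 : ℝ) ≤ (if χ = x then 9 * H ^ 6 + U else 0) := by split_ifs <;> positivity
    have hr3 : 0 ≤ 4 * W ^ 2 * H ^ 3 * ((if χ.Even then ‖ev (q ^ 6) (aA (q * q)) χ‖ ^ 2 else 0) + 6 * H ^ 3 / q) := by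
      have : (0 : ℝ) ≤ (if χ.Even then ‖ev (q ^ 6) (aA (q * q)) χ‖ ^ 2 else 0) := by
        split_ifs <;> positivity
      positivity
    have hn : 0 ≤ ‖ev (q ^ 6) (bA (q * q)) χ‖ ^ 2 := by positivity
    by_cases he : χ.Even
    · by_cases h1 : χ = 1
      · have e1 : (if χ ≠ 1 ∧ χ.Even then 1 / ‖χ.LFunction 1‖ ^ 2 else 0 : ℝ) = 0 :=
          if_neg (fun h => h.1 h1)
        have e2 : (if χ = 1 then 9 * H ^ 6 else 0 : ℝ) = 9 * H ^ 6 := if_pos h1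
        have e3 : (if χ.Even then ‖ev (q ^ 6) (bA (q * q)) χ‖ ^ 2 else 0) =
          ‖ev (q ^ 6) (bA (q * q)) χ‖ ^ 2 := if_pos he
        rw [e1, e2, e3, zero_sub, abs_neg, abs_of_nonneg hn]
        linarith
      · have e1 : (if χ ≠ 1 ∧ χ.Even then 1 / ‖χ.LFunction 1‖ ^ 2 else 0 : ℝ) =
          1 / ‖χ.LFunction 1‖ ^ 2 := if_pos ⟨h1, he⟩
        have e3 : (if χ.Even then ‖ev (q ^ 6) (bA (q * q)) χ‖ ^ 2 else 0) =
          ‖ev (q ^ 6) (bA (q * q)) χ‖ ^ 2 := if_pos he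
        have e4 : (if χ.Even then ‖ev (q ^ 6) (aA (q * q)) χ‖ ^ 2 else 0) =
          ‖ev (q ^ 6) (aA (q * q)) χ‖ ^ 2 := if_pos he
        rw [e4] at hr3
        rw [e1, e3, e4]
        by_cases hxx : χ = x
        · have e5 : (if χ = x then 9 * H ^ 6 + U else 0) = 9 * H ^ 6 + U := if_pos hxx
          rw [e5, abs_le]
          have h2 : 1 / ‖χ.LFunction 1‖ ^ 2 ≤ U := by
            rw [hxx]; exact hx (hxx ▸ h1)
          have h3 : 0 ≤ 1 / ‖χ.LFunction 1‖ ^ 2 := by positivity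
          have h6 : 0 ≤ 9 * H ^ 6 := by positivity
          constructor <;> linarith
        · obtain ⟨h2, h3⟩ := hgood χ h1 hxx
          have := hg χ h1 h2 h3
          linarith
    · have e1 : (if χ ≠ 1 ∧ χ.Even then 1 / ‖χ.LFunction 1‖ ^ 2 else 0 : ℝ) = 0 :=
          if_neg (fun h => he h.2)
      have e3 : (if χ.Even then ‖ev (q ^ 6) (bA (q * q)) χ‖ ^ 2 else 0) = 0 := if_neg he
      rw [e1, e3, sub_zero, abs_zero]
      linarith
  have hcard : (∑ _χ : DirichletCharacter ℂ q, (6 * H ^ 3 / q)) ≤ 6 * H ^ 3 := by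
    have h1 : (Fintype.card (DirichletCharacter ℂ q) : ℝ) ≤ q := by
      rw [← Nat.card_eq_fintype_card, DirichletCharacter.card_eq_totient_of_hasEnoughRootsOfUnity]
      exact_mod_cast Nat.totient_le q
    rw [sum_const, nsmul_eq_mul, Finset.card_univ]
    calc _ ≤ (q : ℝ) * (6 * H ^ 3 / q) := by gcongr
      _ = _ := by field_simp
  have hSB : |(∑ χ : DirichletCharacter ℂ q, if χ ≠ 1 ∧ χ.Even then 1 / ‖χ.LFunction 1‖ ^ 2 else 0) -
      (∑ χ : DirichletCharacter ℂ q, if χ.Even then ‖ev (q ^ 6) (bA (q * q)) χ‖ ^ 2 else 0)| ≤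
      4 * W ^ 2 * H ^ 3 * (3 * V ^ 2 * H ^ 2 + 6 * H ^ 3) + 9 * H ^ 6 + (9 * H ^ 6 + U) := by
    rw [← sum_sub_distrib]
    refine (abs_sum_le_sum_abs _ _).trans ((sum_le_sum fun χ _ => hterm χ).trans ?_)
    rw [sum_add_distrib, sum_add_distrib, ← mul_sum, sum_add_distrib, sum_ite_eq' univ 1,
      sum_ite_eq' univ x, if_pos (mem_univ _), if_pos (mem_univ _)]
    gcongr
  have hW2 : 1 ≤ W ^ 2 := one_le_pow₀ hW
  have h5 : H ^ 5 ≤ H ^ 6 := pow_le_pow_right₀ hH1 (by norm_num)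
  have h2 : H ^ 2 ≤ H ^ 6 := pow_le_pow_right₀ hH1 (by norm_num)
  have hV4 : 1 ≤ V ^ 4 := one_le_pow₀ hV1
  have hV24 : V ^ 2 ≤ V ^ 4 := pow_le_pow_right₀ hV1 (by norm_num)
  have k1 : W ^ 2 * V ^ 2 * H ^ 5 ≤ W ^ 2 * V ^ 4 * H ^ 6 := by gcongr
  have k2 : W ^ 2 * 1 * H ^ 6 ≤ W ^ 2 * V ^ 4 * H ^ 6 := by gcongr
  have k3 : 1 * 1 * H ^ 6 ≤ W ^ 2 * V ^ 4 * H ^ 6 := by gcongr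
  have k4 : 1 * V ^ 4 * H ^ 2 ≤ W ^ 2 * V ^ 4 * H ^ 6 := by gcongr
  have := abs_sub_le (∑ χ : DirichletCharacter ℂ q, if χ ≠ 1 ∧ χ.Even then 1 / ‖χ.LFunction 1‖ ^ 2 else 0)
    (∑ χ : DirichletCharacter ℂ q, if χ.Even then ‖ev (q ^ 6) (bA (q * q)) χ‖ ^ 2 else 0)
    ((q.totient : ℝ) / 2 * AQ q)
  have k5 : 4 * W ^ 2 * H ^ 3 * (3 * V ^ 2 * H ^ 2 + 6 * H ^ 3) =
    12 * (W ^ 2 * V ^ 2 * H ^ 5) + 24 * (W ^ 2 * 1 * H ^ 6) := by ring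
  linarith

end NSM

namespace NSM
open Finset

lemma aq_prime (q : ℕ) {p : ℕ} (hp : p.Prime) :
    ∑' e : ℕ, (if (p ^ e).Coprime q then ((ArithmeticFunction.moebius (p ^ e) : ℤ) : ℝ) ^ 2 *
      (((p ^ e : ℕ) : ℝ) ^ 2)⁻¹ else 0) = if p ∣ q then 1 else 1 + ((p : ℝ) ^ 2)⁻¹ := by
  rw [tsum_eq_sum (s := range 2)]
  · rw [sum_range_succ, sum_range_one]
    by_cases h : p ∣ q
    · have h1 : ¬ (p ^ 1).Coprime q := by
        rw [pow_one, hp.coprime_iff_not_dvd]; tauto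
      rw [if_neg h1, if_pos h]; simp
    · have h1 : (p ^ 1).Coprime q := by
        rw [pow_one, hp.coprime_iff_not_dvd]; exact h
      rw [if_pos h1, if_neg h, pow_one, ArithmeticFunction.moebius_apply_prime hp]; simp
  · intro e he
    rw [mem_range] at he
    have hz : ArithmeticFunction.moebius (p ^ e) = 0 := by
      rw [ArithmeticFunction.moebius_apply_prime_pow hp (by omega), if_neg (by omega)]
    rw [hz]
    simp only [Int.cast_zero, ne_eq, OfNat.ofNat_ne_zero, not_false_eq_true, zero_pow, zero_mul, ite_self]

lemma AQ_hasProd (q : ℕ) :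
    HasProd (fun p : Nat.Primes => if (p : ℕ) ∣ q then (1 : ℝ) else 1 + ((p : ℝ) ^ 2)⁻¹) (AQ q) := by
  have h := EulerProduct.eulerProduct_hasProd (f := fun n : ℕ =>
    if n.Coprime q then ((ArithmeticFunction.moebius n : ℤ) : ℝ) ^ 2 * ((n : ℝ) ^ 2)⁻¹ else 0)
    (by simp) ?_ (aq_summable q).norm (by simp)
  · have e : (fun p : Nat.Primes => ∑' e : ℕ, (if ((p : ℕ) ^ e).Coprime q then
        ((ArithmeticFunction.moebius ((p : ℕ) ^ e) : ℤ) : ℝ) ^ 2 *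
        ((((p : ℕ) ^ e : ℕ) : ℝ) ^ 2)⁻¹ else 0)) =
        fun p : Nat.Primes => if (p : ℕ) ∣ q then (1 : ℝ) else 1 + ((p : ℝ) ^ 2)⁻¹ :=
      funext fun p => aq_prime q p.2
    rw [← e]
    exact h
  · intro m n hmn
    by_cases hm : m.Coprime q
    · by_cases hn : n.Coprime q
      · rw [if_pos hm, if_pos hn, if_pos (Nat.Coprime.mul_left hm hn),
          ArithmeticFunction.isMultiplicative_moebius.map_mul_of_coprime hmn]
        push_cast
        rw [mul_pow, mul_pow, mul_inv]
        ring
      · rw [if_neg hn, if_neg, mul_zero]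
        exact fun h => hn (Nat.Coprime.coprime_mul_left h)
    · rw [if_neg hm, if_neg, zero_mul]
      exact fun h => hm (Nat.Coprime.coprime_mul_right h)

lemma fin_hasProd {q : ℕ} (hq : q ≠ 0) :
    HasProd (fun p : Nat.Primes => if (p : ℕ) ∣ q then 1 + ((p : ℝ) ^ 2)⁻¹ else (1 : ℝ))
      (∏ p ∈ q.primeFactors, (1 + ((p : ℝ) ^ 2)⁻¹)) := by
  set s : Finset Nat.Primes := q.primeFactors.attach.map
    ⟨fun p : q.primeFactors => (⟨p.1, (Nat.mem_primeFactors.1 p.2).1⟩ : Nat.Primes), fun a b h =>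
      Subtype.ext (congrArg (fun z : Nat.Primes => (z : ℕ)) h)⟩ with hs
  have e : ∏ p ∈ q.primeFactors, (1 + ((p : ℝ) ^ 2)⁻¹) =
      ∏ p ∈ s, (if (p : ℕ) ∣ q then 1 + ((p : ℝ) ^ 2)⁻¹ else (1 : ℝ)) := by
    rw [hs, prod_map, ← prod_attach]
    refine prod_congr rfl fun p _ => ?_
    have := (Nat.mem_primeFactors.1 p.2).2.1
    exact (if_pos this).symm
  rw [e]
  refine hasProd_prod_of_ne_finset_one fun p hp => if_neg fun hd => hp ?_
  rw [hs, mem_map]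
  exact ⟨⟨p.1, Nat.mem_primeFactors.2 ⟨p.2, hd, hq⟩⟩, mem_attach _ _, rfl⟩

lemma AQ_eq {q : ℕ} (hq : q ≠ 0) :
    AQ q = (riemannZeta 2 / riemannZeta 4).re * ∏ p ∈ q.primeFactors, (1 + ((p : ℝ) ^ 2)⁻¹)⁻¹ := by
  set G := ∏ p ∈ q.primeFactors, (1 + ((p : ℝ) ^ 2)⁻¹) with hG
  have hG0 : G ≠ 0 := prod_ne_zero_iff.2 fun p _ => by positivity
  have h1 := ((AQ_hasProd q).mul (fin_hasProd hq)).map Complex.ofRealHom Complex.continuous_ofReal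
  have h2 := riemannZeta_eulerProduct_hasProd (s := 2) (by norm_num)
  have h4 := riemannZeta_eulerProduct_hasProd (s := 4) (by norm_num)
  have h3 := h1.mul h4
  have h5 : riemannZeta 2 = (((AQ q * G : ℝ) : ℂ)) * riemannZeta 4 := by
    refine h2.unique ?_
    have e0 : (((AQ q * G : ℝ) : ℂ)) * riemannZeta 4 = Complex.ofRealHom (AQ q * G) * riemannZeta 4 := rfl
    rw [e0]
    convert h3 using 1
    funext p
    have hp : (1 : ℝ) < (p : ℕ) := by exact_mod_cast p.2.one_lt
    have hpc : ((p : ℕ) : ℂ) ≠ 0 := by exact_mod_cast p.2.ne_zero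
    have e1 : ((p : ℕ) : ℂ) ^ (-2 : ℂ) = (((p : ℕ) : ℂ) ^ 2)⁻¹ := by
      rw [Complex.cpow_neg]; norm_cast
    have e2 : ((p : ℕ) : ℂ) ^ (-4 : ℂ) = (((p : ℕ) : ℂ) ^ 2)⁻¹ ^ 2 := by
      rw [Complex.cpow_neg]
      have : ((p : ℕ) : ℂ) ^ (4 : ℂ) = ((p : ℕ) : ℂ) ^ 4 := by norm_cast
      rw [this, inv_pow, ← pow_mul]
    have e3 : (Complex.ofRealHom ∘ fun p : Nat.Primes => (if (p : ℕ) ∣ q then (1 : ℝ) else 1 + ((p : ℝ) ^ 2)⁻¹) *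
        (if (p : ℕ) ∣ q then 1 + ((p : ℝ) ^ 2)⁻¹ else (1 : ℝ))) p = 1 + (((p : ℕ) : ℂ) ^ 2)⁻¹ := by
      by_cases h : (p : ℕ) ∣ q <;> simp [h]
    rw [e3, e1, e2]
    set y : ℝ := (((p : ℕ) : ℝ) ^ 2)⁻¹ with hy
    have hyc : (((p : ℕ) : ℂ) ^ 2)⁻¹ = (y : ℂ) := by rw [hy]; push_cast; rfl
    have hy1 : y < 1 := inv_lt_one_of_one_lt₀ (one_lt_pow₀ hp (by norm_num))
    have hy0 : 0 < y := by positivity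
    rw [hyc]
    norm_cast
    have a1 : (1 - y) ≠ 0 := by linarith
    have a2 : (1 - y ^ 2) ≠ 0 := by nlinarith
    field_simp
    ring
  have hz4 : riemannZeta 4 ≠ 0 := riemannZeta_ne_zero_of_one_le_re (by norm_num)
  rw [h5, mul_div_assoc, div_self hz4, mul_one, Complex.ofReal_re, prod_inv_distrib, mul_assoc,
    mul_inv_cancel₀ hG0, mul_one]

lemma main_term {q : ℕ} (hq : q ≠ 0) :
    (q.totient : ℝ) / 2 * AQ q = (riemannZeta 2 / (2 * riemannZeta 4)).re *
      (∏ p ∈ q.primeFactors, (1 + ((p : ℝ) ^ 2)⁻¹)⁻¹) * q.totient := by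
  rw [AQ_eq hq]
  have : riemannZeta 2 / (2 * riemannZeta 4) = ((1 / 2 : ℝ) : ℂ) * (riemannZeta 2 / riemannZeta 4) := by
    push_cast
    rw [mul_comm (2 : ℂ), ← div_div]; ring
  rw [this, Complex.re_ofReal_mul]
  ring

end NSM

namespace NSM
open Finset

lemma err_bound {q : ℕ} (hq : 3 ≤ q) {K : ℝ} (hK : 1 ≤ K) {C : ℝ}
    (hC : Real.log (57 * K ^ 2 * 8 ^ 6) + 184 ≤ C) :
    57 * (K * Real.log q ^ 7) ^ 2 * Real.exp (26 * TT q) ^ 4 * HH (q ^ 6) ^ 6 ≤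
      Real.exp (C * Real.log q / Real.log (Real.log q)) := by
  have hl := one_lt_log hq
  have hT := one_le_TT hq
  have hH1 : 1 ≤ HH (q ^ 6) := one_le_HH (Nat.one_le_pow _ _ (by omega))
  have hK1 : 1 ≤ 57 * K ^ 2 * 8 ^ 6 := by nlinarith
  have e1 : Real.exp (26 * TT q) ^ 4 = Real.exp (104 * TT q) := by
    rw [← Real.exp_nat_mul]; congr 1; push_cast; ring
  have h20 := log_pow_le hq 20
  have hc := const_le hq hK1
  calc 57 * (K * Real.log q ^ 7) ^ 2 * Real.exp (26 * TT q) ^ 4 * HH (q ^ 6) ^ 6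
      ≤ 57 * (K * Real.log q ^ 7) ^ 2 * Real.exp (104 * TT q) * (8 * Real.log q) ^ 6 := by
        rw [e1]
        gcongr
        exact HH_le hq
    _ = (57 * K ^ 2 * 8 ^ 6) * Real.log q ^ 20 * Real.exp (104 * TT q) := by ring
    _ ≤ Real.exp (Real.log (57 * K ^ 2 * 8 ^ 6) * TT q) * Real.exp (4 * (20 : ℕ) * TT q) *
          Real.exp (104 * TT q) := by gcongr
    _ = Real.exp ((Real.log (57 * K ^ 2 * 8 ^ 6) + 184) * TT q) := by
        rw [← Real.exp_add, ← Real.exp_add]; congr 1; push_cast; ring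
    _ ≤ Real.exp (C * TT q) := by gcongr
    _ = _ := by rw [TT, mul_div_assoc]

lemma inv_of_lower {c ℓ x : ℝ} (hc : 0 < c) (hℓ : 0 < ℓ) (h : c / ℓ ≤ x) :
    1 / x ≤ max 1 c⁻¹ * ℓ := by
  have h0 : 0 < c / ℓ := by positivity
  calc 1 / x ≤ 1 / (c / ℓ) := one_div_le_one_div_of_le h0 h
    _ = c⁻¹ * ℓ := by field_simp
    _ ≤ _ := by gcongr; exact le_max_right _ _

end NSM

open Complex DirichletCharacter

open scoped Classical in
/-- There exist absolute constants `C > 0` and `c0 > 0` such that for every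
integer `q ≥ 3`: if no nonprincipal Dirichlet character mod `q` has a real zero
`β ≥ 1 - c0 / log q`, then the negative second moment of `L(1,χ)` over nonprincipal even
characters equals `(ζ(2)/(2ζ(4))) ∏_{p ∣ q} (1+p⁻²)⁻¹ φ(q)` up to
`exp(C log q / log log q)`; if an exceptional zero `β1` exists (for a nonprincipal real
character `χ1`), the error also involves `C (1-β1)⁻¹ ((log q)² + (1-β1)⁻¹)`. -/
theorem negative_square_moment_even :
    ∃ C > (0 : ℝ), ∃ c0 > (0 : ℝ), ∀ (q : ℕ) [NeZero q], 3 ≤ q →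
      let S : ℝ := ∑ χ : DirichletCharacter ℂ q,
        if χ ≠ 1 ∧ χ.Even then 1 / ‖χ.LFunction 1‖ ^ 2 else 0
      let M : ℝ := (riemannZeta 2 / (2 * riemannZeta 4)).re *
        (∏ p ∈ q.primeFactors, (1 + ((p : ℝ) ^ 2)⁻¹)⁻¹) * q.totient
      ((∀ χ : DirichletCharacter ℂ q, χ ≠ 1 → ∀ β : ℝ,
          1 - c0 / Real.log q ≤ β → χ.LFunction (β : ℂ) ≠ 0) →
        |S - M| ≤ Real.exp (C * Real.log q / Real.log (Real.log q))) ∧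
      (∀ (χ1 : DirichletCharacter ℂ q) (β1 : ℝ),
          χ1 ≠ 1 → (∀ a : ZMod q, (starRingEnd ℂ) (χ1 a) = χ1 a) →
          χ1.LFunction (β1 : ℂ) = 0 → 1 - c0 / Real.log q ≤ β1 →
        |S - M| ≤ Real.exp (C * Real.log q / Real.log (Real.log q)) +
          C * (1 - β1)⁻¹ * ((Real.log q) ^ 2 + (1 - β1)⁻¹)) := by
  obtain ⟨c, hc, c0, hc0, hLB⟩ := NSM.LB
  set K := max 1 c⁻¹ with hK
  have hK1 : 1 ≤ K := le_max_left _ _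
  have hlog : 0 ≤ Real.log (57 * K ^ 2 * 8 ^ 6) := Real.log_nonneg (by nlinarith)
  refine ⟨Real.log (57 * K ^ 2 * 8 ^ 6) + 184 + c⁻¹ ^ 2, by positivity, c0, hc0, ?_⟩
  intro q _ hq S M
  have hl := NSM.one_lt_log hq
  have hl7 : 1 ≤ Real.log q ^ 7 := one_le_pow₀ hl.le
  have hW : 1 ≤ K * Real.log q ^ 7 := one_le_mul_of_one_le_of_one_le hK1 hl7
  have hM : M = (q.totient : ℝ) / 2 * NSM.AQ q := (NSM.main_term (by omega)).symm
  have hC : Real.log (57 * K ^ 2 * 8 ^ 6) + 184 ≤ Real.log (57 * K ^ 2 * 8 ^ 6) + 184 + c⁻¹ ^ 2 := by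
    have : 0 ≤ c⁻¹ ^ 2 := by positivity
    linarith
  have herr := NSM.err_bound hq hK1 hC
  obtain ⟨h1, h2⟩ := hLB q hq
  have good : ∀ χ : DirichletCharacter ℂ q, c / Real.log q ^ 7 ≤ ‖χ.LFunction 1‖ →
      χ.LFunction 1 ≠ 0 ∧ 1 / ‖χ.LFunction 1‖ ≤ K * Real.log q ^ 7 := by
    intro χ h
    refine ⟨fun h0 => ?_, NSM.inv_of_lower hc (by positivity) h⟩
    rw [h0, norm_zero] at h
    have : 0 < c / Real.log q ^ 7 := by positivity
    linarith
  constructor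
  · intro hno
    have hg := h1 hno
    have := NSM.main_bound hq hW le_rfl 1 (fun χ hχ _ => good χ (hg χ hχ)) (fun h => absurd rfl h)
    rw [hM]
    rw [add_zero] at this
    exact this.trans herr
  · intro χ1 β1 hχ1 hreal hz hβ
    obtain ⟨hb1, hlow, hg⟩ := h2 χ1 β1 hχ1 hreal hz hβ
    have hd : 0 < 1 - β1 := by linarith
    have hU : 1 / ‖χ1.LFunction 1‖ ^ 2 ≤ c⁻¹ ^ 2 * (1 - β1)⁻¹ ^ 2 := by
      calc 1 / ‖χ1.LFunction 1‖ ^ 2 ≤ 1 / (c * (1 - β1)) ^ 2 := by gcongr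
        _ = _ := by field_simp
    have := NSM.main_bound hq hW (by positivity) χ1 (fun χ hχ hx => good χ (hg χ hχ hx)) (fun _ => hU)
    rw [hM]
    refine this.trans (add_le_add herr ?_)
    have hd' : 0 < (1 - β1)⁻¹ := by positivity
    have p1 : 0 ≤ (Real.log (57 * K ^ 2 * 8 ^ 6) + 184) * (1 - β1)⁻¹ * (Real.log q ^ 2 + (1 - β1)⁻¹) := by
      positivity
    have p2 : 0 ≤ c⁻¹ ^ 2 * (1 - β1)⁻¹ * Real.log q ^ 2 := by positivity
    nlinarith
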